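/- Let X be a Banach space and Γ : [0,1] → cwk(X) a variationally Henstock integrable multifunction. Then Γ decomposes as Γ = G + f, where f is a variationally Henstock integrable selection of Γ and G : [0,1] → cwk(X) is a multifunction that is both Birkhoff integrable and variationally Henstock integrable. -/

import Mathlib

open Set Metric MeasureTheory Pointwise
open scoped ENNReal NNReal

namespace GaugePaper

variable (X : Type*) [NormedAddCommGroup X] [NormedSpace ℝ X]

/-- `A ∈ cwk(X)`: `A` is a nonempty, convex and weakly compact subset of `X`. -/
def IsCWK (A : Set X) : Prop :=
  A.Nonempty ∧ Convex ℝ A ∧ IsCompact (toWeakSpace ℝ X '' A)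

variable {X}

/-- The support function `σ(x*, A)`. -/
noncomputable def suppFn (x' : X →L[ℝ] ℝ) (A : Set X) : ℝ := sSup (x' '' A)

/-- `‖A‖ = sup {‖x‖ : x ∈ A}`. -/
noncomputable def setNorm (A : Set X) : ℝ := sSup ((fun x => ‖x‖) '' A)

/-- A gauge on `[0,1]`: a positive function. -/
def IsGauge (δ : ℝ → ℝ) : Prop := ∀ t ∈ Icc (0:ℝ) 1, 0 < δ t

/-- A tagged partition of `[0,1]` into `n` (possibly degenerate) nonoverlapping closed
subintervals `[pt i, pt (i+1)]`, with tags `tag i ∈ [0,1]`. -/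
structure TP (n : ℕ) where
  pt : Fin (n + 1) → ℝ
  tag : Fin n → ℝ
  mono : Monotone pt
  first : pt 0 = 0
  last : pt (Fin.last n) = 1
  tagMem : ∀ i, tag i ∈ Icc (0:ℝ) 1

namespace TP

variable {n : ℕ} (P : TP n)

/-- The `i`-th subinterval of the partition. -/
def ivl (i : Fin n) : Set ℝ := Icc (P.pt i.castSucc) (P.pt i.succ)

/-- The length `|I_i|` of the `i`-th subinterval. -/
def len (i : Fin n) : ℝ := P.pt i.succ - P.pt i.castSucc

/-- A Perron (Henstock) partition: each tag belongs to its interval. -/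
def IsPerron : Prop := ∀ i, P.tag i ∈ P.ivl i

/-- `δ`-fineness: `I_i ⊆ (t_i - δ(t_i), t_i + δ(t_i))`. -/
def IsFine (δ : ℝ → ℝ) : Prop :=
  ∀ i, P.ivl i ⊆ Ioo (P.tag i - δ (P.tag i)) (P.tag i + δ (P.tag i))

/-- An interior Henstock partition: each tag is in the interior of its interval, except
possibly for intervals containing `0` or `1`, where the tag may also be `0` or `1`. -/
def IsInterior : Prop :=
  ∀ i, P.tag i ∈ Ioo (P.pt i.castSucc) (P.pt i.succ) ∨
    (((0:ℝ) ∈ P.ivl i ∨ (1:ℝ) ∈ P.ivl i) ∧ P.tag i ∈ P.ivl i ∩ ({0, 1} : Set ℝ))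

end TP

/-- Riemann sum of a multifunction: `∑ i |I_i| • Γ(t_i)` (Minkowski sums). -/
def mSum {n : ℕ} (P : TP n) (Γ : ℝ → Set X) : Set X :=
  ∑ i : Fin n, P.len i • Γ (P.tag i)

/-- Riemann sum of a function: `∑ i |I_i| • f(t_i)`. -/
def fSum {n : ℕ} (P : TP n) (f : ℝ → X) : X :=
  ∑ i : Fin n, P.len i • f (P.tag i)

/-! ### Gauge integrals of multifunctions -/

/-- Henstock integrability of a multifunction `Γ : [0,1] → cwk(X)`. -/
def HenstockIntegrable (Γ : ℝ → Set X) : Prop :=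
  ∃ I : Set X, IsCWK X I ∧ ∀ ε > 0, ∃ δ : ℝ → ℝ, IsGauge δ ∧
    ∀ (n : ℕ) (P : TP n), P.IsPerron → P.IsFine δ → hausdorffDist I (mSum P Γ) < ε

/-- McShane integrability of a multifunction (free tags). -/
def McShaneIntegrable (Γ : ℝ → Set X) : Prop :=
  ∃ I : Set X, IsCWK X I ∧ ∀ ε > 0, ∃ δ : ℝ → ℝ, IsGauge δ ∧
    ∀ (n : ℕ) (P : TP n), P.IsFine δ → hausdorffDist I (mSum P Γ) < ε

/-- `ℋ`-integrability: Henstock integrability with Lebesgue measurable gauges. -/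
def HMeasIntegrable (Γ : ℝ → Set X) : Prop :=
  ∃ I : Set X, IsCWK X I ∧ ∀ ε > 0, ∃ δ : ℝ → ℝ, IsGauge δ ∧ AEMeasurable δ volume ∧
    ∀ (n : ℕ) (P : TP n), P.IsPerron → P.IsFine δ → hausdorffDist I (mSum P Γ) < ε

/-- Birkhoff (`ℳ`-) integrability: McShane integrability with Lebesgue measurable gauges. -/
def BirkhoffIntegrable (Γ : ℝ → Set X) : Prop :=
  ∃ I : Set X, IsCWK X I ∧ ∀ ε > 0, ∃ δ : ℝ → ℝ, IsGauge δ ∧ AEMeasurable δ volume ∧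
    ∀ (n : ℕ) (P : TP n), P.IsFine δ → hausdorffDist I (mSum P Γ) < ε

/-! ### Gauge integrals of (single-valued) functions -/

/-- Henstock integrability of a function `f : [0,1] → X`. -/
def FHenstockIntegrable (f : ℝ → X) : Prop :=
  ∃ w : X, ∀ ε > 0, ∃ δ : ℝ → ℝ, IsGauge δ ∧
    ∀ (n : ℕ) (P : TP n), P.IsPerron → P.IsFine δ → ‖w - fSum P f‖ < ε

/-- McShane integrability of a function. -/
def FMcShaneIntegrable (f : ℝ → X) : Prop :=
  ∃ w : X, ∀ ε > 0, ∃ δ : ℝ → ℝ, IsGauge δ ∧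
    ∀ (n : ℕ) (P : TP n), P.IsFine δ → ‖w - fSum P f‖ < ε

/-- `ℋ`-integrability of a function: measurable gauges. -/
def FHMeasIntegrable (f : ℝ → X) : Prop :=
  ∃ w : X, ∀ ε > 0, ∃ δ : ℝ → ℝ, IsGauge δ ∧ AEMeasurable δ volume ∧
    ∀ (n : ℕ) (P : TP n), P.IsPerron → P.IsFine δ → ‖w - fSum P f‖ < ε

/-- Birkhoff (`ℳ`-) integrability of a function: McShane with measurable gauges. -/
def FBirkhoffIntegrable (f : ℝ → X) : Prop :=
  ∃ w : X, ∀ ε > 0, ∃ δ : ℝ → ℝ, IsGauge δ ∧ AEMeasurable δ volume ∧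
    ∀ (n : ℕ) (P : TP n), P.IsFine δ → ‖w - fSum P f‖ < ε

/-- Henstock–Kurzweil integrability of a real-valued function on `[0,1]`. -/
def HKIntegrable (g : ℝ → ℝ) : Prop :=
  ∃ A : ℝ, ∀ ε > 0, ∃ δ : ℝ → ℝ, IsGauge δ ∧
    ∀ (n : ℕ) (P : TP n), P.IsPerron → P.IsFine δ → |fSum P g - A| < ε

/-! ### Pettis integrals -/

/-- Pettis integrability of a function `f : [0,1] → X`. -/
def FPettisIntegrable (f : ℝ → X) : Prop :=
  (∀ x' : X →L[ℝ] ℝ, IntegrableOn (fun t => x' (f t)) (Icc (0:ℝ) 1) volume) ∧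
  ∀ E ⊆ Icc (0:ℝ) 1, NullMeasurableSet E volume →
    ∃ ν : X, ∀ x' : X →L[ℝ] ℝ, x' ν = ∫ t in E, x' (f t)

/-- Pettis integrability of a multifunction `Γ : [0,1] → cwk(X)`. -/
def PettisIntegrable (Γ : ℝ → Set X) : Prop :=
  (∀ x' : X →L[ℝ] ℝ, IntegrableOn (fun t => suppFn x' (Γ t)) (Icc (0:ℝ) 1) volume) ∧
  ∀ E ⊆ Icc (0:ℝ) 1, NullMeasurableSet E volume →
    ∃ W : Set X, IsCWK X W ∧ ∀ x' : X →L[ℝ] ℝ, suppFn x' W = ∫ t in E, suppFn x' (Γ t)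

/-- `f` is a selection of `Γ`. -/
def Selection (Γ : ℝ → Set X) (f : ℝ → X) : Prop := ∀ t ∈ Icc (0:ℝ) 1, f t ∈ Γ t

/-! ### Variational integrals -/

/-- Finite additivity of an interval multifunction on subintervals of `[0,1]`
(an interval `[a,b] ⊆ [0,1]` is encoded by its endpoints). -/
def AdditiveIntervalMF (Φ : ℝ → ℝ → Set X) : Prop :=
  ∀ a b c : ℝ, 0 ≤ a → a ≤ b → b ≤ c → c ≤ 1 → Φ a c = Φ a b + Φ b c

/-- Finite additivity of a vector-valued interval function on subintervals of `[0,1]`. -/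
def AdditiveIntervalF (Φ : ℝ → ℝ → X) : Prop :=
  ∀ a b c : ℝ, 0 ≤ a → a ≤ b → b ≤ c → c ≤ 1 → Φ a c = Φ a b + Φ b c

/-- `Φ` is a variational Henstock primitive of the multifunction `Γ`. -/
def vHPrimitive (Γ : ℝ → Set X) (Φ : ℝ → ℝ → Set X) : Prop :=
  (∀ a b : ℝ, 0 ≤ a → a ≤ b → b ≤ 1 → IsCWK X (Φ a b)) ∧ AdditiveIntervalMF Φ ∧
  ∀ ε > 0, ∃ δ : ℝ → ℝ, IsGauge δ ∧ ∀ (n : ℕ) (P : TP n), P.IsPerron → P.IsFine δ →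
    ∑ i : Fin n, hausdorffDist (Φ (P.pt i.castSucc) (P.pt i.succ)) (P.len i • Γ (P.tag i)) < ε

/-- Variational Henstock integrability of a multifunction. -/
def vHIntegrable (Γ : ℝ → Set X) : Prop := ∃ Φ : ℝ → ℝ → Set X, vHPrimitive Γ Φ

/-- Variational McShane integrability of a multifunction (free tags). -/
def vMSIntegrable (Γ : ℝ → Set X) : Prop :=
  ∃ Φ : ℝ → ℝ → Set X,
    (∀ a b : ℝ, 0 ≤ a → a ≤ b → b ≤ 1 → IsCWK X (Φ a b)) ∧ AdditiveIntervalMF Φ ∧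
    ∀ ε > 0, ∃ δ : ℝ → ℝ, IsGauge δ ∧ ∀ (n : ℕ) (P : TP n), P.IsFine δ →
      ∑ i : Fin n, hausdorffDist (Φ (P.pt i.castSucc) (P.pt i.succ)) (P.len i • Γ (P.tag i)) < ε

/-- Variational `ℋ`-integrability of a multifunction: measurable gauges. -/
def vHMeasIntegrable (Γ : ℝ → Set X) : Prop :=
  ∃ Φ : ℝ → ℝ → Set X,
    (∀ a b : ℝ, 0 ≤ a → a ≤ b → b ≤ 1 → IsCWK X (Φ a b)) ∧ AdditiveIntervalMF Φ ∧
    ∀ ε > 0, ∃ δ : ℝ → ℝ, IsGauge δ ∧ AEMeasurable δ volume ∧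
      ∀ (n : ℕ) (P : TP n), P.IsPerron → P.IsFine δ →
        ∑ i : Fin n, hausdorffDist (Φ (P.pt i.castSucc) (P.pt i.succ)) (P.len i • Γ (P.tag i)) < ε

/-- `Φ` is a variational Henstock primitive of the function `f`. -/
def FvHPrimitive (f : ℝ → X) (Φ : ℝ → ℝ → X) : Prop :=
  AdditiveIntervalF Φ ∧
  ∀ ε > 0, ∃ δ : ℝ → ℝ, IsGauge δ ∧ ∀ (n : ℕ) (P : TP n), P.IsPerron → P.IsFine δ →
    ∑ i : Fin n, ‖Φ (P.pt i.castSucc) (P.pt i.succ) - P.len i • f (P.tag i)‖ < ε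

/-- Variational Henstock integrability of a function. -/
def FvHIntegrable (f : ℝ → X) : Prop := ∃ Φ : ℝ → ℝ → X, FvHPrimitive f Φ

/-- Variational McShane integrability of a function (free tags). -/
def FvMSIntegrable (f : ℝ → X) : Prop :=
  ∃ Φ : ℝ → ℝ → X, AdditiveIntervalF Φ ∧
    ∀ ε > 0, ∃ δ : ℝ → ℝ, IsGauge δ ∧ ∀ (n : ℕ) (P : TP n), P.IsFine δ →
      ∑ i : Fin n, ‖Φ (P.pt i.castSucc) (P.pt i.succ) - P.len i • f (P.tag i)‖ < ε

/-- Variational `ℋ`-integrability of a function: measurable gauges. -/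
def FvHMeasIntegrable (f : ℝ → X) : Prop :=
  ∃ Φ : ℝ → ℝ → X, AdditiveIntervalF Φ ∧
    ∀ ε > 0, ∃ δ : ℝ → ℝ, IsGauge δ ∧ AEMeasurable δ volume ∧
      ∀ (n : ℕ) (P : TP n), P.IsPerron → P.IsFine δ →
        ∑ i : Fin n, ‖Φ (P.pt i.castSucc) (P.pt i.succ) - P.len i • f (P.tag i)‖ < ε

/-! ### Partial Perron partitions and variational measures -/

/-- A finite tagged Perron family of `n` nonoverlapping closed subintervals
`[a i, b i]` of `[0,1]` (a "partition in `[0,1]`", not necessarily covering it). -/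
structure PTP (n : ℕ) where
  a : Fin n → ℝ
  b : Fin n → ℝ
  tag : Fin n → ℝ
  le : ∀ i, a i ≤ b i
  sub : ∀ i, Icc (a i) (b i) ⊆ Icc (0:ℝ) 1
  nonoverlap : ∀ i j, i ≠ j → (Icc (a i) (b i) ∩ Icc (a j) (b j)).Subsingleton
  perron : ∀ i, tag i ∈ Icc (a i) (b i)

/-- `δ`-fineness of a partial Perron family. -/
def PTP.IsFine {n : ℕ} (P : PTP n) (δ : ℝ → ℝ) : Prop :=
  ∀ i, Icc (P.a i) (P.b i) ⊆ Ioo (P.tag i - δ (P.tag i)) (P.tag i + δ (P.tag i))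

/-- `Var(Ψ, δ, E)` for a scalar interval function `Ψ`. -/
noncomputable def scVar (Ψ : ℝ → ℝ → ℝ) (δ : ℝ → ℝ) (E : Set ℝ) : ℝ≥0∞ :=
  ⨆ (n : ℕ) (P : PTP n) (_ : P.IsFine δ ∧ ∀ i, P.tag i ∈ E),
    ∑ i : Fin n, ENNReal.ofReal |Ψ (P.a i) (P.b i)|

/-- The variational measure `V_Ψ(E)` generated by a scalar interval function `Ψ`. -/
noncomputable def scVarMeasure (Ψ : ℝ → ℝ → ℝ) (E : Set ℝ) : ℝ≥0∞ :=
  ⨅ (δ : ℝ → ℝ) (_ : IsGauge δ), scVar Ψ δ E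

open Filter Topology

section Partitions

/-- Cousin's lemma as an induction principle along fine Perron intervals. -/
theorem cousin_induction {δ : ℝ → ℝ} (hδ : IsGauge δ) {Q : ℝ → Prop} {a : ℝ} (ha0 : 0 ≤ a)
    (ha : Q a)
    (step : ∀ c d t, a ≤ c → c ≤ t → t ≤ d → d ≤ 1 → t - δ t < c → d < t + δ t → Q c → Q d)
    {x : ℝ} (hax : a ≤ x) (hx1 : x ≤ 1) : Q x := by
  set S : Set ℝ := {c | a ≤ c ∧ c ≤ x ∧ Q c} with hS
  have haS : a ∈ S := ⟨le_rfl, hax, ha⟩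
  have hbdd : BddAbove S := ⟨x, fun c hc => hc.2.1⟩
  set s := sSup S with hs
  have has : a ≤ s := le_csSup hbdd haS
  have hsx : s ≤ x := csSup_le ⟨a, haS⟩ fun c hc => hc.2.1
  have hpos : 0 < δ s := hδ s ⟨ha0.trans has, hsx.trans hx1⟩
  obtain ⟨c, hcS, hc⟩ := exists_lt_of_lt_csSup ⟨a, haS⟩ (show s - δ s < s by linarith)
  have hcs : c ≤ s := le_csSup hbdd hcS
  have hd : ∀ d, s ≤ d → d ≤ x → d < s + δ s → Q d := fun d h1 h2 h3 =>
    step c d s hcS.1 hcs h1 (h2.trans hx1) hc h3 hcS.2.2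
  rcases hsx.eq_or_lt with h | h
  · exact h ▸ hd s le_rfl hsx (by linarith)
  · exfalso
    have hlt : s < min x (s + δ s / 2) := lt_min h (by linarith)
    have : min x (s + δ s / 2) ∈ S :=
      ⟨has.trans hlt.le, min_le_left _ _, hd _ hlt.le (min_le_left _ _)
        ((min_le_right _ _).trans_lt (by linarith))⟩
    exact absurd (le_csSup hbdd this) (not_le.2 hlt)

/-- `FineChain δ c x s`: there is a `δ`-fine Perron partition of `[0,x]` whose total cost, for the
cost `c a b t` of the tagged interval `([a,b],t)`, is `s`. -/
inductive FineChain (δ : ℝ → ℝ) (c : ℝ → ℝ → ℝ → ℝ) : ℝ → ℝ → Prop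
  | nil : FineChain δ c 0 0
  | snoc (a b t s : ℝ) (hat : a ≤ t) (htb : t ≤ b) (hb : b ≤ 1) (h₁ : t - δ t < a)
      (h₂ : b < t + δ t) (h : FineChain δ c a s) : FineChain δ c b (s + c a b t)

theorem FineChain.exists_points {δ : ℝ → ℝ} {c : ℝ → ℝ → ℝ → ℝ} {x s : ℝ}
    (h : FineChain δ c x s) :
    ∃ (n : ℕ) (p τ : ℕ → ℝ), p 0 = 0 ∧ p n = x ∧
      (∀ i < n, p i ≤ τ i ∧ τ i ≤ p (i + 1) ∧ τ i - δ (τ i) < p i ∧ p (i + 1) < τ i + δ (τ i)) ∧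
      s = ∑ i ∈ Finset.range n, c (p i) (p (i + 1)) (τ i) := by
  induction h with
  | nil => exact ⟨0, fun _ => 0, fun _ => 0, rfl, rfl, by simp, by simp⟩
  | snoc a b t s hat htb hb h₁ h₂ h ih =>
    obtain ⟨n, p, τ, h0, hn, hp, hs⟩ := ih
    refine ⟨n + 1, fun i => if i ≤ n then p i else b, fun i => if i < n then τ i else t,
      by simp [h0], by simp, ?_, ?_⟩
    · intro i hi
      rcases (Nat.lt_succ_iff.1 hi).lt_or_eq with h | rfl
      · simpa [h, h.le, Nat.succ_le_iff.2 h] using hp i h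
      · simpa [hn] using ⟨hat, htb, h₁, h₂⟩
    · rw [Finset.sum_range_succ]
      congr 1
      · rw [hs]
        refine Finset.sum_congr rfl fun i hi => ?_
        have h := Finset.mem_range.1 hi
        simp [h, h.le, Nat.succ_le_iff.2 h]
      · simp [hn]

/-- A bound for the variational sums over all fine Perron partitions yields a monotone function
whose increments dominate the cost of every fine tagged interval. -/
theorem exists_monotone_majorant {δ : ℝ → ℝ} (hδ : IsGauge δ) {c : ℝ → ℝ → ℝ → ℝ}
    (hc : ∀ a b t, 0 ≤ c a b t) {ε : ℝ}
    (h : ∀ (n : ℕ) (P : TP n), P.IsPerron → P.IsFine δ →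
      ∑ i : Fin n, c (P.pt i.castSucc) (P.pt i.succ) (P.tag i) ≤ ε) :
    ∃ V : ℝ → ℝ, Monotone V ∧ V 1 - V 0 ≤ ε ∧ (∀ x, x ≤ 0 → V x = V 0) ∧
      (∀ x, 1 ≤ x → V x = V 1) ∧
      ∀ a b t, 0 ≤ a → a ≤ t → t ≤ b → b ≤ 1 → t - δ t < a → b < t + δ t →
        c a b t ≤ V b - V a := by
  have hext : ∀ {a s x : ℝ}, 0 ≤ a → FineChain δ c a s → a ≤ x → x ≤ 1 →
      ∃ s', s ≤ s' ∧ FineChain δ c x s' := by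
    intro a s x h0 hch hax hx1
    refine cousin_induction hδ h0 (Q := fun x => ∃ s', s ≤ s' ∧ FineChain δ c x s')
      ⟨s, le_rfl, hch⟩ ?_ hax hx1
    rintro c' d t - h1 h2 h3 h4 h5 ⟨s', hs', hch'⟩
    exact ⟨_, hs'.trans (le_add_of_nonneg_right (hc _ _ _)), .snoc c' d t s' h1 h2 h3 h4 h5 hch'⟩
  have htop : ∀ {s : ℝ}, FineChain δ c 1 s → s ≤ ε := by
    intro s hs
    obtain ⟨n, p, τ, h0, hn, hp, rfl⟩ := hs.exists_points
    have hmono : Monotone fun i : Fin (n + 1) => p i := by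
      refine Fin.monotone_iff_le_succ.2 fun i => ?_
      have := hp i i.2
      simpa using this.1.trans this.2.1
    let P : TP n :=
      { pt := fun i => p i
        tag := fun i => τ i
        mono := hmono
        first := h0
        last := hn
        tagMem := fun i => by
          have h1 := hp i i.2
          have h2 := hmono (Fin.zero_le i.castSucc)
          have h3 := hmono (Fin.le_last i.succ)
          simp only [Fin.val_zero, Fin.val_castSucc, Fin.val_succ, Fin.val_last, h0, hn] at h2 h3
          exact ⟨h2.trans h1.1, h1.2.1.trans h3⟩ }
    have := h n P (fun i => ⟨(hp i i.2).1, (hp i i.2).2.1⟩)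
      (fun i y hy => ⟨(hp i i.2).2.2.1.trans_le hy.1, hy.2.trans_lt (hp i i.2).2.2.2⟩)
    rwa [← Fin.sum_univ_eq_sum_range (fun i => c (p i) (p (i + 1)) (τ i))]
  have hbdd : ∀ {x : ℝ}, 0 ≤ x → x ≤ 1 → BddAbove {s | FineChain δ c x s} := by
    intro x h0 h1
    refine ⟨ε, fun s hs => ?_⟩
    obtain ⟨s', hs', hch⟩ := hext h0 hs h1 le_rfl
    exact hs'.trans (htop hch)
  have hne : ∀ {x : ℝ}, 0 ≤ x → x ≤ 1 → {s | FineChain δ c x s}.Nonempty := by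
    intro x h0 h1
    obtain ⟨s', -, hch⟩ := hext le_rfl .nil h0 h1
    exact ⟨s', hch⟩
  set U : ℝ → ℝ := fun x => sSup {s | FineChain δ c x s} with hU
  have hUmono : ∀ a b, 0 ≤ a → a ≤ b → b ≤ 1 → U a ≤ U b := by
    intro a b h0 hab h1
    refine csSup_le (hne h0 (hab.trans h1)) fun s hs => ?_
    obtain ⟨s', hs', hch⟩ := hext h0 hs hab h1
    exact hs'.trans (le_csSup (hbdd (h0.trans hab) h1) hch)
  have hcl : ∀ x : ℝ, 0 ≤ max 0 (min x 1) ∧ max 0 (min x 1) ≤ 1 := fun x =>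
    ⟨le_max_left _ _, max_le zero_le_one (min_le_right _ _)⟩
  refine ⟨fun x => U (max 0 (min x 1)), ?_, ?_, ?_, ?_, ?_⟩
  · intro x y hxy
    exact hUmono _ _ (hcl x).1 (max_le_max le_rfl (min_le_min hxy le_rfl)) (hcl y).2
  · have h1 : U 1 ≤ ε := csSup_le (hne zero_le_one le_rfl) fun s hs => htop hs
    have h0 : 0 ≤ U 0 := le_csSup (hbdd le_rfl zero_le_one) .nil
    norm_num
    linarith
  · intro x hx
    simp [min_eq_left (hx.trans zero_le_one), hx]
  · intro x hx
    simp [hx]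
  · intro a b t h0 hat htb hb h1 h2
    have ha1 : a ≤ 1 := (hat.trans htb).trans hb
    have hb0 : 0 ≤ b := h0.trans (hat.trans htb)
    simp only [min_eq_left ha1, min_eq_left hb, max_eq_right h0, max_eq_right hb0]
    rw [le_sub_iff_add_le']
    refine le_of_forall_pos_le_add fun η hη => ?_
    obtain ⟨s, hs, hlt⟩ := exists_lt_of_lt_csSup (hne h0 ha1) (show U a - η < U a by linarith)
    have := le_csSup (hbdd hb0 hb) (FineChain.snoc a b t s hat htb hb h1 h2 hs)
    change s + c a b t ≤ U b at this
    linarith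

end Partitions

theorem TP.castSucc_le_succ {n : ℕ} (P : TP n) (i : Fin n) : P.pt i.castSucc ≤ P.pt i.succ :=
  P.mono i.castSucc_le_succ

theorem TP.pt_nonneg {n : ℕ} (P : TP n) (i : Fin (n + 1)) : 0 ≤ P.pt i :=
  P.first ▸ P.mono (Fin.zero_le _)

theorem TP.pt_le_one {n : ℕ} (P : TP n) (i : Fin (n + 1)) : P.pt i ≤ 1 :=
  P.last ▸ P.mono (Fin.le_last _)

theorem TP.sum_increments {n : ℕ} (P : TP n) {Z : Type*} [AddCommGroup Z] (V : ℝ → Z) :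
    ∑ i : Fin n, (V (P.pt i.succ) - V (P.pt i.castSucc)) = V 1 - V 0 := by
  have h₁ := Fin.sum_univ_succ fun i => V (P.pt i)
  have h₂ := Fin.sum_univ_castSucc fun i => V (P.pt i)
  rw [P.first] at h₁
  rw [P.last] at h₂
  rw [Finset.sum_sub_distrib, sub_eq_sub_iff_add_eq_add, add_comm, ← h₁, h₂, add_comm]

section Control

variable {Z : Type*} [NormedAddCommGroup Z] [NormedSpace ℝ Z]

/-- The increments of `V` dominate the variational error between `F` and `g` on the tagged
intervals that are `δ`-fine, with the tag in the interval. -/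
structure PerronControl (g F : ℝ → Z) (δ V : ℝ → ℝ) (ε : ℝ) : Prop where
  gauge : IsGauge δ
  mono : Monotone V
  total : V 1 - V 0 ≤ ε
  bound : ∀ a b t, 0 ≤ a → a ≤ t → t ≤ b → b ≤ 1 → t - δ t < a → b < t + δ t →
    ‖F b - F a - (b - a) • g t‖ ≤ V b - V a

/-- `F` is a variational Henstock primitive of `g`, expressed by monotone majorants. -/
def VarHenstock (g F : ℝ → Z) : Prop :=
  ∀ ε > 0, ∃ δ V, PerronControl g F δ V ε ∧ (∀ x, x ≤ 0 → V x = V 0) ∧ ∀ x, 1 ≤ x → V x = V 1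

theorem PerronControl.sum_le {g F : ℝ → Z} {δ V : ℝ → ℝ} {ε : ℝ} (h : PerronControl g F δ V ε)
    {n : ℕ} (P : TP n) (hP : P.IsPerron) (hfine : P.IsFine δ) :
    ∑ i : Fin n, ‖F (P.pt i.succ) - F (P.pt i.castSucc) - P.len i • g (P.tag i)‖ ≤ ε := by
  have hle := P.castSucc_le_succ
  calc _ ≤ ∑ i : Fin n, (V (P.pt i.succ) - V (P.pt i.castSucc)) :=
        Finset.sum_le_sum fun i _ => h.bound _ _ _ (P.pt_nonneg _) (hP i).1 (hP i).2
          (P.pt_le_one _) (hfine i (left_mem_Icc.2 (hle i))).1 (hfine i (right_mem_Icc.2 (hle i))).2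
    _ = V 1 - V 0 := P.sum_increments V
    _ ≤ ε := h.total

theorem varHenstock_of_sum_lt {g F : ℝ → Z}
    (h : ∀ ε > 0, ∃ δ : ℝ → ℝ, IsGauge δ ∧ ∀ (n : ℕ) (P : TP n), P.IsPerron → P.IsFine δ →
      ∑ i : Fin n, ‖F (P.pt i.succ) - F (P.pt i.castSucc) - P.len i • g (P.tag i)‖ < ε) :
    VarHenstock g F := by
  intro ε hε
  obtain ⟨δ, hδ, hsum⟩ := h ε hε
  obtain ⟨V, h1, h2, h3, h4, h5⟩ := exists_monotone_majorant hδ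
    (c := fun a b t => ‖F b - F a - (b - a) • g t‖) (fun _ _ _ => norm_nonneg _)
    (fun n P hP hf => (hsum n P hP hf).le)
  exact ⟨δ, V, ⟨hδ, h1, h2, h5⟩, h3, h4⟩

end Control

section Bochner

/-- An index satisfying a measurable property can be chosen measurably. -/
theorem exists_measurable_index {α : Type*} [MeasurableSpace α] {p : α → ℕ → Prop}
    (hp : ∀ m, MeasurableSet {t | p t m}) :
    ∃ u : α → ℕ, Measurable u ∧ ∀ t, (∃ m, p t m) → p t (u t) := by
  classical
  have hq : ∀ t, ∃ m, p t m ∨ ¬ ∃ m, p t m := fun t => by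
    by_cases H : ∃ m, p t m
    · exact H.imp fun m hm => Or.inl hm
    · exact ⟨0, Or.inr H⟩
  have hU : MeasurableSet {t | ∃ m, p t m} := by
    convert MeasurableSet.iUnion hp
    ext t
    simp
  exact ⟨fun t => Nat.find (hq t), measurable_find hq fun k => (hp k).union hU.compl,
    fun t ht => (Nat.find_spec (hq t)).resolve_right (not_not.2 ht)⟩

variable {Z : Type*} [NormedAddCommGroup Z]

/-- Near each point of a null set, an integrable function is dominated by a function of small
integral. -/
theorem exists_gauge_of_null {μ : Measure ℝ} [IsFiniteMeasure μ] {h : ℝ → Z}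
    (hh : Integrable h μ) {N : Set ℝ} (hN : μ N = 0) {ε : ℝ≥0∞} (hε : ε ≠ 0) :
    ∃ w : ℝ → ℝ≥0∞, AEMeasurable w μ ∧ ∫⁻ x, w x ∂μ ≤ ε ∧
      ∀ t ∈ N, ∃ δ > 0, ∀ x, |x - t| < δ → ‖h x - h t‖ₑ ≤ w x := by
  have hε2 : ε / 2 ≠ 0 := by simp [hε]
  have : IsFiniteMeasure (μ.withDensity fun x => ‖h x‖ₑ) :=
    isFiniteMeasure_withDensity hh.hasFiniteIntegral.ne
  obtain ⟨U, hNU, hU, hUlt⟩ := Set.exists_isOpen_lt_of_lt (μ := μ.withDensity fun x => ‖h x‖ₑ) N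
    (ε / 2) (by
      rw [withDensity_absolutelyContinuous μ _ hN]
      exact pos_iff_ne_zero.2 hε2)
  rw [withDensity_apply _ hU.measurableSet] at hUlt
  have hk : N.indicator (fun x => ‖h x‖₊) =ᵐ[μ] 0 := by
    filter_upwards [measure_eq_zero_iff_ae_notMem.1 hN] with x hx
    simp [hx]
  obtain ⟨v, hv, hvlsc, hvint⟩ := exists_lt_lowerSemicontinuous_lintegral_ge_of_aemeasurable μ
    (N.indicator fun x => ‖h x‖₊) ⟨0, measurable_zero, hk⟩ hε2
  have hk0 : ∫⁻ x, ((N.indicator (fun x => ‖h x‖₊) x : ℝ≥0) : ℝ≥0∞) ∂μ = 0 := by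
    rw [lintegral_congr_ae (g := 0) (hk.mono fun x hx => by rw [hx]; rfl)]
    simp
  rw [hk0, zero_add] at hvint
  refine ⟨fun x => U.indicator (fun x => ‖h x‖ₑ) x + v x,
    (hh.aestronglyMeasurable.enorm.indicator hU.measurableSet).add hvlsc.measurable.aemeasurable,
    ?_, fun t ht => ?_⟩
  · rw [lintegral_add_right _ hvlsc.measurable, lintegral_indicator hU.measurableSet]
    exact (add_le_add hUlt.le hvint).trans (ENNReal.add_halves ε).le
  · have hvt : (‖h t‖₊ : ℝ≥0∞) < v t := by simpa [ht] using hv t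
    obtain ⟨δ, hδ, hball⟩ := Metric.eventually_nhds_iff.1
      ((hU.eventually_mem (hNU ht)).and (hvlsc t _ hvt))
    refine ⟨δ, hδ, fun x hx => ?_⟩
    obtain ⟨hxU, hxv⟩ := hball (Real.dist_eq x t ▸ hx)
    simp only [indicator_of_mem hxU]
    exact (enorm_sub_le).trans (add_le_add le_rfl hxv.le)

variable [NormedSpace ℝ Z]

/-- An integrable function is controlled in the mean by a measurable gauge. -/
theorem exists_gauge_lintegral_le {μ : Measure ℝ} [IsFiniteMeasure μ] {h : ℝ → Z}
    (hh : Integrable h μ) {ε : ℝ≥0∞} (hε : ε ≠ 0) (hε' : ε ≠ ∞) :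
    ∃ (δ : ℝ → ℝ) (w : ℝ → ℝ≥0∞), (∀ t, 0 < δ t) ∧ AEMeasurable δ μ ∧ AEMeasurable w μ ∧
      ∫⁻ x, w x ∂μ ≤ ε ∧ ∀ t x, |x - t| < δ t → ‖h x - h t‖ₑ ≤ w x := by
  classical
  have hε3 : ε / 3 ≠ 0 := by simp [hε]
  obtain ⟨η, hη, hημ⟩ := ENNReal.exists_nnreal_pos_mul_lt (measure_ne_top μ univ) hε3
  have hη2 : (0 : ℝ≥0∞) < ↑(η / 2) := ENNReal.coe_pos.2 (half_pos hη)
  obtain ⟨e, he, hesum⟩ := ENNReal.exists_pos_sum_of_countable hε3 ℕ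
  choose g hgc hgle hgcont hgint using fun m : ℕ =>
    hh.exists_hasCompactSupport_lintegral_sub_le (ε := e m) (by simpa using (he m).ne')
  choose r hr hrg using fun m => Metric.uniformContinuous_iff.1
    ((hgc m).uniformContinuous_of_continuous (hgcont m)) ↑(η / 2) (by positivity)
  have hum : ∀ m, AEMeasurable (fun x => ‖h x - g m x‖ₑ) μ := fun m =>
    (hh.aestronglyMeasurable.sub (hgint m).aestronglyMeasurable).enorm
  have hsm : AEMeasurable (fun x => ∑' m, ‖h x - g m x‖ₑ) μ := AEMeasurable.tsum hum
  have hsint : ∫⁻ x, ∑' m, ‖h x - g m x‖ₑ ∂μ ≤ ε / 3 := by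
    rw [lintegral_tsum hum]
    exact (ENNReal.tsum_le_tsum hgle).trans hesum.le
  obtain ⟨h', hh', hae⟩ := hh.aestronglyMeasurable
  let p : ℝ → ℕ → Prop := fun t m => ‖h' t - g m t‖ₑ < ↑(η / 2)
  have hpm : ∀ m, MeasurableSet {t | p t m} := fun m =>
    measurableSet_lt (hh'.sub (hgcont m).stronglyMeasurable).enorm measurable_const
  have hpae : ∀ᵐ t ∂μ, h t = h' t ∧ ∃ m, p t m := by
    filter_upwards [hae, ae_lt_top' hsm (hsint.trans_lt
      (ENNReal.div_lt_top hε' (by norm_num))).ne] with t ht hts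
    refine ⟨ht, ?_⟩
    obtain ⟨m, hm⟩ := ((ENNReal.tendsto_atTop_zero_of_tsum_ne_top hts.ne).eventually_lt_const
      hη2).exists
    exact ⟨m, by simpa only [p, ← ht] using hm⟩
  obtain ⟨u, hum', hu⟩ := exists_measurable_index hpm
  obtain ⟨v, hvm, hvint, hv⟩ := exists_gauge_of_null hh (ae_iff.1 hpae) hε3
  choose! δN hδN hδNv using hv
  refine ⟨fun t => if h t = h' t ∧ ∃ m, p t m then r (u t) else δN t,
    fun x => η + ∑' m, ‖h x - g m x‖ₑ + v x, ?_, ?_, (hsm.const_add _).add hvm, ?_, ?_⟩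
  · intro t
    dsimp only
    split_ifs with ht
    · exact hr _
    · exact hδN t ht
  · refine ⟨fun t => r (u t), (measurable_of_countable r).comp hum', ?_⟩
    filter_upwards [hpae] with t ht
    simp only [if_pos ht]
  · rw [lintegral_add_right' _ hvm, lintegral_add_right' _ hsm, lintegral_const]
    calc _ ≤ ε / 3 + ε / 3 + ε / 3 := by gcongr
      _ = ε := ENNReal.add_thirds ε
  · intro t x hx
    dsimp only at hx
    split_ifs at hx with ht
    · have hm := hu t ht.2
      set m := u t
      have h1 : ‖g m x - g m t‖ₑ ≤ ↑(η / 2) := by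
        rw [← edist_eq_enorm_sub]
        exact (edist_lt_coe.2 (hrg m (Real.dist_eq x t ▸ hx))).le
      have h2 : ‖g m t - h t‖ₑ ≤ ↑(η / 2) := by
        rw [ht.1, ← edist_eq_enorm_sub, edist_comm, edist_eq_enorm_sub]
        exact hm.le
      have h3 : ‖h x - g m x‖ₑ ≤ ∑' m, ‖h x - g m x‖ₑ := ENNReal.le_tsum m
      calc ‖h x - h t‖ₑ = ‖(h x - g m x) + ((g m x - g m t) + (g m t - h t))‖ₑ := by
            congr 1; abel
        _ ≤ ‖h x - g m x‖ₑ + (‖g m x - g m t‖ₑ + ‖g m t - h t‖ₑ) :=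
            (enorm_add_le _ _).trans (add_le_add le_rfl (enorm_add_le _ _))
        _ ≤ ∑' m, ‖h x - g m x‖ₑ + (↑(η / 2) + ↑(η / 2)) := by gcongr
        _ = η + ∑' m, ‖h x - g m x‖ₑ := by
            rw [← ENNReal.coe_add, add_halves, add_comm]
        _ ≤ _ := le_self_add
    · exact (hδNv t ht x hx).trans le_add_self

/-- A sequence of integrable functions is controlled on `[0,1]` by measurable gauges for free
tagged intervals, with a common monotone majorant of small total increment. -/
theorem exists_free_control [CompleteSpace Z] {h : ℕ → ℝ → Z}
    (hh : ∀ k, IntegrableOn (h k) (Icc 0 1)) {ε : ℝ} (hε : 0 < ε) :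
    ∃ (δ : ℕ → ℝ → ℝ) (V : ℝ → ℝ), (∀ k t, 0 < δ k t) ∧
      (∀ k, AEMeasurable (δ k) (volume.restrict (Icc 0 1))) ∧ Monotone V ∧ V 1 - V 0 ≤ ε ∧
      ∀ k a b t, 0 ≤ a → a ≤ b → b ≤ 1 → t - δ k t < a → b < t + δ k t →
        ‖(∫ x in a..b, h k x) - (b - a) • h k t‖ ≤ V b - V a := by
  obtain ⟨e, he, hesum⟩ := ENNReal.exists_pos_sum_of_countable
    (ENNReal.ofReal_pos.2 hε).ne' ℕ
  choose δ w hδ hδm hwm hwint hw using fun k => exists_gauge_lintegral_le (hh k)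
    (ε := e k) (by simpa using (he k).ne') ENNReal.coe_ne_top
  set W : ℝ → ℝ≥0∞ := fun x => ∑' k, w k x with hW
  have hWint : ∫⁻ x in Icc 0 1, W x ≤ ENNReal.ofReal ε := by
    rw [hW, lintegral_tsum hwm]
    exact (ENNReal.tsum_le_tsum hwint).trans hesum.le
  set μ : Measure ℝ := volume.restrict (Icc 0 1) with hμ
  have hfin : ∀ s, ∫⁻ x in s, W x ∂μ ≠ ∞ := fun s =>
    ((setLIntegral_le_lintegral s _).trans_lt (hWint.trans_lt ENNReal.ofReal_lt_top)).ne
  refine ⟨δ, fun x => (∫⁻ y in Iic x, W y ∂μ).toReal, hδ, hδm, ?_, ?_, ?_⟩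
  · intro x y hxy
    exact ENNReal.toReal_mono (hfin _) (lintegral_mono_set (Iic_subset_Iic.2 hxy))
  · refine (sub_le_self _ ENNReal.toReal_nonneg).trans (ENNReal.toReal_le_of_le_ofReal hε.le ?_)
    exact (setLIntegral_le_lintegral _ _).trans hWint
  · intro k a b t ha hab hb h1 h2
    have hsub : Ioc a b ⊆ Icc 0 1 := fun x hx => ⟨ha.trans hx.1.le, hx.2.trans hb⟩
    have hμI : μ.restrict (Ioc a b) = volume.restrict (Ioc a b) :=
      Measure.restrict_restrict_of_subset hsub
    have hinteg : IntegrableOn (h k) (Ioc a b) := (hh k).mono_set hsub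
    have hinc : (∫⁻ y in Iic b, W y ∂μ).toReal - (∫⁻ y in Iic a, W y ∂μ).toReal
        = (∫⁻ y in Ioc a b, W y ∂μ).toReal := by
      rw [← Iic_union_Ioc_eq_Iic hab, lintegral_union measurableSet_Ioc
        (Iic_disjoint_Ioc le_rfl), ENNReal.toReal_add (hfin _) (hfin _), add_sub_cancel_left]
    dsimp only
    rw [hinc]
    have heq : (∫ x in a..b, h k x) - (b - a) • h k t = ∫ x in Ioc a b, (h k x - h k t) := by
      rw [integral_sub hinteg (integrable_const _), intervalIntegral.integral_of_le hab]
      simp [hab]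
    rw [heq, ← ENNReal.ofReal_le_iff_le_toReal (hfin _), ofReal_norm]
    refine (enorm_integral_le_lintegral_enorm _).trans ?_
    rw [hμI]
    refine setLIntegral_mono' measurableSet_Ioc fun x hx => ?_
    refine (hw k t x ?_).trans (ENNReal.le_tsum k)
    rw [abs_lt]
    exact ⟨by linarith [hx.1], by linarith [hx.2]⟩

end Bochner

section Differentiation

/-- Monotone functions with arbitrarily small total increment over `[0,1]` have arbitrarily small
derivatives almost everywhere. -/
theorem ae_exists_hasDerivAt_lt {V : ℕ → ℝ → ℝ} (hV : ∀ j, Monotone (V j))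
    (h0 : ∀ j x, x ≤ 0 → V j x = V j 0) (h1 : ∀ j x, 1 ≤ x → V j x = V j 1)
    (hlim : ∀ ε > 0, ∃ j, V j 1 - V j 0 ≤ ε) :
    ∀ᵐ t ∂volume.restrict (Icc (0:ℝ) 1), ∀ ε > 0, ∃ j, ∃ v < ε, HasDerivAt (V j) v t := by
  set ρ : ℕ → ℝ → ℝ≥0∞ := fun j => (hV j).stieltjesFunction.measure.rnDeriv volume with hρ
  have hρm : Measurable fun t => ⨅ j, ρ j t :=
    Measurable.iInf fun j => Measure.measurable_rnDeriv _ _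
  have hbound : ∀ j, ∫⁻ t in Icc 0 1, ρ j t ≤ ENNReal.ofReal (V j 1 - V j 0) := by
    intro j
    calc ∫⁻ t in Icc 0 1, ρ j t ≤ (hV j).stieltjesFunction.measure (Icc 0 1) :=
          Measure.setLIntegral_rnDeriv_le _
      _ ≤ (hV j).stieltjesFunction.measure (Ioc (-1) 2) :=
          measure_mono fun x hx => ⟨by linarith [hx.1], by linarith [hx.2]⟩
      _ ≤ ENNReal.ofReal (V j 1 - V j 0) := by
          rw [StieltjesFunction.measure_Ioc]
          refine ENNReal.ofReal_le_ofReal (sub_le_sub ?_ ?_)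
          · rw [Monotone.stieltjesFunction_eq, ← h1 j 3 (by norm_num)]
            exact (hV j).rightLim_le (by norm_num)
          · rw [Monotone.stieltjesFunction_eq, ← h0 j (-1) (by norm_num)]
            exact (hV j).le_rightLim le_rfl
  have hzero : ∫⁻ t in Icc 0 1, ⨅ j, ρ j t = 0 := by
    refine le_antisymm (ENNReal.le_of_forall_pos_le_add fun ε hε _ => ?_) zero_le
    obtain ⟨j, hj⟩ := hlim ε hε
    rw [zero_add]
    refine (lintegral_mono fun t => iInf_le _ j).trans ((hbound j).trans ?_)
    rw [← ENNReal.ofReal_coe_nnreal]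
    exact ENNReal.ofReal_le_ofReal hj
  filter_upwards [(lintegral_eq_zero_iff hρm).1 hzero,
    ae_restrict_of_ae (ae_all_iff.2 fun j => (hV j).ae_hasDerivAt)] with t ht hd ε hε
  have hlt : ⨅ j, ρ j t < ENNReal.ofReal ε := by
    rw [ht]
    exact ENNReal.ofReal_pos.2 hε
  obtain ⟨j, hj⟩ := iInf_lt_iff.1 hlt
  exact ⟨j, _, (ENNReal.lt_ofReal_iff_toReal_lt hj.ne_top).1 hj, hd j⟩

variable {Z : Type*} [NormedAddCommGroup Z] [NormedSpace ℝ Z] {g F : ℝ → Z}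

theorem VarHenstock.continuousOn (h : VarHenstock g F) : ContinuousOn F (Icc 0 1) := by
  refine Metric.continuousOn_iff.2 fun t ht ε hε => ?_
  obtain ⟨δ, V, hV, -, -⟩ := h (ε / 2) (half_pos hε)
  have hpos : 0 < ε / 2 / (1 + ‖g t‖) := by positivity
  refine ⟨min (δ t) (ε / 2 / (1 + ‖g t‖)), lt_min (hV.gauge t ht) hpos, fun b hb hbt => ?_⟩
  rw [Real.dist_eq, lt_min_iff, abs_lt, lt_div_iff₀ (by positivity)] at hbt
  obtain ⟨⟨hb1, hb2⟩, hb3⟩ := hbt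
  have hδ := hV.gauge t ht
  have hV1 : ∀ x ∈ Icc (0:ℝ) 1, ∀ y ∈ Icc (0:ℝ) 1, V x - V y ≤ ε / 2 := fun x hx y hy => by
    linarith [hV.total, hV.mono hx.2, hV.mono hy.1]
  have key : ‖F b - F t - (b - t) • g t‖ ≤ ε / 2 := by
    rcases le_total t b with htb | htb
    · exact (hV.bound t b t ht.1 le_rfl htb hb.2 (by linarith) (by linarith)).trans
        (hV1 b hb t ht)
    · rw [← norm_neg, show -(F b - F t - (b - t) • g t) = F t - F b - (t - b) • g t by
        rw [show t - b = -(b - t) by ring, neg_smul]; abel]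
      exact (hV.bound b t t hb.1 htb le_rfl ht.2 (by linarith) (by linarith)).trans
        (hV1 t ht b hb)
  have h2 : ‖(b - t) • g t‖ < ε / 2 := by
    rw [norm_smul, Real.norm_eq_abs]
    nlinarith [abs_nonneg (b - t), norm_nonneg (g t)]
  rw [dist_eq_norm]
  calc ‖F b - F t‖ = ‖(F b - F t - (b - t) • g t) + (b - t) • g t‖ := by congr 1; abel
    _ ≤ _ := norm_add_le _ _
    _ < ε := by linarith

theorem VarHenstock.aestronglyMeasurable (h : VarHenstock g F) :
    AEStronglyMeasurable g (volume.restrict (Icc 0 1)) := by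
  have hcl : ∀ x : ℝ, max 0 (min x 1) ∈ Icc (0:ℝ) 1 := fun x =>
    ⟨le_max_left _ _, max_le zero_le_one (min_le_right _ _)⟩
  set F' : ℝ → Z := fun x => F (max 0 (min x 1)) with hF'
  have hF'c : Continuous F' :=
    h.continuousOn.comp_continuous (by fun_prop) hcl
  have hF'eq : ∀ x ∈ Icc (0:ℝ) 1, F' x = F x := fun x hx => by
    simp [hF', min_eq_left hx.2, max_eq_right hx.1]
  choose δ V hV hV0 hV1 using fun j : ℕ => h (1 / (j + 1)) (by positivity)
  have hlim : ∀ ε > 0, ∃ j, V j 1 - V j 0 ≤ ε := fun ε hε => by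
    obtain ⟨j, hj⟩ := exists_nat_one_div_lt hε
    exact ⟨j, (hV j).total.trans hj.le⟩
  set u : ℕ → ℝ := fun n => 1 / ((n : ℝ) + 1) with hu
  have hupos : ∀ n, 0 < u n := fun n => by positivity
  have hu0 : Tendsto u atTop (𝓝[>] 0) :=
    tendsto_nhdsWithin_iff.2 ⟨tendsto_one_div_add_atTop_nhds_zero_nat, .of_forall hupos⟩
  refine aestronglyMeasurable_of_tendsto_ae atTop
    (f := fun n t => (u n)⁻¹ • (F' (t + u n) - F' t))
    (fun n => Continuous.aestronglyMeasurable (by fun_prop)) ?_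
  have hne : ∀ᵐ t ∂volume.restrict (Icc (0:ℝ) 1), t ≠ 1 :=
    ae_restrict_of_ae (measure_eq_zero_iff_ae_notMem.1 (measure_singleton 1))
  filter_upwards [ae_exists_hasDerivAt_lt (fun j => (hV j).mono) hV0 hV1 hlim, hne,
    ae_restrict_mem measurableSet_Icc] with t ht hne1 hmem
  have ht1 : t < 1 := lt_of_le_of_ne hmem.2 hne1
  refine tendsto_iff_norm_sub_tendsto_zero.2 (Metric.tendsto_atTop'.2 fun ε hε => ?_)
  obtain ⟨j, v, hvε, hv⟩ := ht ε hε
  have hev := ((hv.tendsto_slope_zero_right.comp hu0).eventually_lt_const hvε).and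
    (((tendsto_nhdsWithin_iff.1 hu0).1.eventually_lt_const (sub_pos.2 ht1)).and
      ((tendsto_nhdsWithin_iff.1 hu0).1.eventually_lt_const ((hV j).gauge t hmem)))
  obtain ⟨N, hN⟩ := eventually_atTop.1 hev
  refine ⟨N, fun n hn => ?_⟩
  obtain ⟨hn1, hn2, hn3⟩ := hN n hn.le
  have hun := hupos n
  have hb := (hV j).bound t (t + u n) t hmem.1 le_rfl (by linarith) (by linarith)
    (by linarith [(hV j).gauge t hmem]) (by linarith)
  rw [dist_zero_right, norm_norm, hF'eq t hmem, hF'eq _ ⟨by linarith [hmem.1], by linarith⟩]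
  have heq : (u n)⁻¹ • (F (t + u n) - F t) - g t
      = (u n)⁻¹ • (F (t + u n) - F t - (t + u n - t) • g t) := by
    rw [add_sub_cancel_left, smul_sub _ _ (u n • g t), inv_smul_smul₀ hun.ne']
  rw [heq, norm_smul, Real.norm_of_nonneg (by positivity)]
  exact (mul_le_mul_of_nonneg_left hb (by positivity)).trans_lt hn1

end Differentiation

section Support

variable {X : Type*} [NormedAddCommGroup X] [NormedSpace ℝ X]

theorem continuous_toWeakSpace_symm_apply (x' : X →L[ℝ] ℝ) :
    Continuous fun x : WeakSpace ℝ X => x' ((toWeakSpace ℝ X).symm x) :=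
  WeakBilin.eval_continuous (topDualPairing ℝ X).flip x'

theorem IsCWK.isBounded {A : Set X} (hA : IsCWK X A) : Bornology.IsBounded A := by
  obtain ⟨C, hC⟩ := banach_steinhaus
    (g := fun a : A => NormedSpace.inclusionInDoubleDualLi ℝ (a : X)) (fun x' => by
      obtain ⟨C, hC⟩ :=
        (hA.2.2.image (continuous_toWeakSpace_symm_apply x')).isBounded.exists_norm_le
      refine ⟨C, fun a => hC _ ⟨_, ⟨a, a.2, rfl⟩, ?_⟩⟩
      simp [NormedSpace.inclusionInDoubleDualLi])
  refine isBounded_iff_forall_norm_le.2 ⟨C, fun a ha => ?_⟩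
  exact ((NormedSpace.inclusionInDoubleDualLi ℝ).norm_map a).symm.trans_le (hC ⟨a, ha⟩)

theorem IsCWK.isClosed {A : Set X} (hA : IsCWK X A) : IsClosed A := by
  have := hA.2.2.isClosed.preimage (toWeakSpaceCLM ℝ X).continuous
  convert this
  ext x
  simp [toWeakSpaceCLM_eq_toWeakSpace]

theorem IsCWK.singleton (x : X) : IsCWK X {x} :=
  ⟨singleton_nonempty x, convex_singleton x, by simp⟩

theorem IsCWK.add {A B : Set X} (hA : IsCWK X A) (hB : IsCWK X B) : IsCWK X (A + B) := by
  refine ⟨hA.1.add hB.1, hA.2.1.add hB.2.1, ?_⟩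
  rw [image_add]
  exact hA.2.2.add hB.2.2

theorem IsCWK.smul {A : Set X} (hA : IsCWK X A) (c : ℝ) : IsCWK X (c • A) := by
  refine ⟨hA.1.smul_set, hA.2.1.smul c, ?_⟩
  rw [image_smul_set]
  exact hA.2.2.smul c

variable {A B : Set X} (x' : X →L[ℝ] ℝ)

theorem bddAbove_image_of_isBounded (hA : Bornology.IsBounded A) : BddAbove (x' '' A) :=
  (hA.image x').bddAbove

theorem le_suppFn (hA : Bornology.IsBounded A) {a : X} (ha : a ∈ A) : x' a ≤ suppFn x' A :=
  le_csSup (bddAbove_image_of_isBounded x' hA) (mem_image_of_mem _ ha)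

theorem suppFn_le (hA : A.Nonempty) {c : ℝ} (h : ∀ a ∈ A, x' a ≤ c) : suppFn x' A ≤ c :=
  csSup_le (hA.image _) (forall_mem_image.2 h)

theorem suppFn_add (hA : A.Nonempty) (hA' : Bornology.IsBounded A) (hB : B.Nonempty)
    (hB' : Bornology.IsBounded B) : suppFn x' (A + B) = suppFn x' A + suppFn x' B := by
  rw [suppFn, image_add, csSup_add (hA.image _) (bddAbove_image_of_isBounded x' hA') (hB.image _)
    (bddAbove_image_of_isBounded x' hB')]
  rfl

theorem suppFn_smul {c : ℝ} (hc : 0 ≤ c) : suppFn x' (c • A) = c * suppFn x' A := by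
  rw [suppFn, image_smul_set, Real.sSup_smul_of_nonneg hc]
  rfl

theorem suppFn_singleton (x : X) : suppFn x' {x} = x' x := by simp [suppFn]

/-- A point is close to a convex set if no functional separates it much from the set. -/
theorem infDist_le_of_forall_le_suppFn (hA : A.Nonempty)
    (hconv : Convex ℝ A) {x : X} {r : ℝ} (hr : 0 ≤ r)
    (h : ∀ x' : X →L[ℝ] ℝ, ‖x'‖ ≤ 1 → x' x ≤ suppFn x' A + r) : infDist x A ≤ r := by
  by_contra! hlt
  set ρ := infDist x A with hρ
  have hρ0 : 0 < ρ := hr.trans_lt hlt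
  obtain ⟨f, u, hfu, huf⟩ := geometric_hahn_banach_open (convex_ball x ρ) isOpen_ball hconv
    disjoint_ball_infDist
  have hx := hfu x (mem_ball_self hρ0)
  have hball : ∀ y : X, ‖y‖ = 1 → f y ≤ (u - f x) / ρ := by
    intro y hy
    rw [le_div_iff₀ hρ0]
    by_contra! hc
    have hy0 : 0 < f y := pos_of_mul_pos_left (lt_trans (sub_pos.2 hx) hc) hρ0.le
    obtain ⟨q, hq, hq'⟩ : ∃ q, (u - f x) / f y < q ∧ q < ρ := exists_between (by
      rw [div_lt_iff₀ hy0]; linarith)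
    have hq0 : 0 < q := (div_pos (sub_pos.2 hx) hy0).trans hq
    have := hfu (x + q • y) (by simpa [norm_smul, hy, abs_of_pos hq0] using hq')
    rw [div_lt_iff₀ hy0] at hq
    rw [map_add, map_smul, smul_eq_mul] at this
    linarith
  have hnorm : ‖f‖ ≤ (u - f x) / ρ :=
    ContinuousLinearMap.opNorm_le_of_unit_norm (div_nonneg (sub_pos.2 hx).le hρ0.le) fun y hy => by
      rw [Real.norm_eq_abs, abs_le]
      refine ⟨?_, hball y hy⟩
      have := hball (-y) (by rwa [norm_neg])
      rw [map_neg] at this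
      linarith
  obtain ⟨b, hb⟩ := hA
  have hf0 : 0 < ‖f‖ := norm_pos_iff.2 fun h0 => by
    have := huf b hb
    simp only [h0, _root_.zero_apply] at this hx
    linarith
  rw [le_div_iff₀ hρ0] at hnorm
  have h1 := h (-(‖f‖⁻¹ • f)) (by simp [norm_smul, hf0.ne'])
  have h2 : suppFn (-(‖f‖⁻¹ • f)) A ≤ -(‖f‖⁻¹ * u) :=
    suppFn_le _ ⟨b, hb⟩ fun a ha => by
      simpa using mul_le_mul_of_nonneg_left (huf a ha) (inv_nonneg.2 hf0.le)
  have h3 : ‖f‖⁻¹ * (u - f x) ≤ r := by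
    simp only [_root_.neg_apply, _root_.smul_apply, smul_eq_mul] at h1
    linarith
  rw [inv_mul_le_iff₀ hf0] at h3
  nlinarith

variable (X) in
/-- The space of bounded functions on the dual unit ball. -/
abbrev SuppSpace : Type _ := lp (fun _ : {x' : X →L[ℝ] ℝ // ‖x'‖ ≤ 1} => ℝ) ∞

/-- The support function of `A`, restricted to the dual unit ball. -/
noncomputable def suppEmb (A : Set X) : SuppSpace X :=
  open scoped Classical in
  if h : Memℓp (fun s : {x' : X →L[ℝ] ℝ // ‖x'‖ ≤ 1} => suppFn s.1 A) ∞ then ⟨_, h⟩ else 0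

theorem suppEmb_apply (hA : A.Nonempty) (hA' : Bornology.IsBounded A)
    (s : {x' : X →L[ℝ] ℝ // ‖x'‖ ≤ 1}) : suppEmb A s = suppFn s.1 A := by
  have h : Memℓp (fun s : {x' : X →L[ℝ] ℝ // ‖x'‖ ≤ 1} => suppFn s.1 A) ∞ := by
    obtain ⟨C, hC⟩ := hA'.exists_norm_le
    have hbd : ∀ s : {x' : X →L[ℝ] ℝ // ‖x'‖ ≤ 1}, ∀ a ∈ A, |s.1 a| ≤ C := fun s a ha =>
      (s.1.le_of_opNorm_le s.2 a).trans (by simpa using hC a ha)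
    refine memℓp_infty ⟨C, ?_⟩
    rintro _ ⟨s, rfl⟩
    obtain ⟨a, ha⟩ := hA
    refine abs_le.2 ?_
    exact ⟨(neg_le_of_abs_le (hbd s a ha)).trans (le_suppFn s.1 hA' ha),
      suppFn_le s.1 ⟨a, ha⟩ fun a ha => (le_abs_self _).trans (hbd s a ha)⟩
  rw [suppEmb, dif_pos h]

theorem SuppSpace.norm_le {y : SuppSpace X} {c : ℝ} (h : ∀ s, |y s| ≤ c) : ‖y‖ ≤ c :=
  lp.norm_le_of_forall_le ((abs_nonneg _).trans (h ⟨0, by simp⟩)) h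

theorem SuppSpace.abs_le (y : SuppSpace X) (s : {x' : X →L[ℝ] ℝ // ‖x'‖ ≤ 1}) : |y s| ≤ ‖y‖ :=
  lp.norm_apply_le_norm ENNReal.top_ne_zero y s

theorem suppEmb_add (hA : A.Nonempty) (hA' : Bornology.IsBounded A) (hB : B.Nonempty)
    (hB' : Bornology.IsBounded B) : suppEmb (A + B) = suppEmb A + suppEmb B := by
  ext s
  rw [lp.coeFn_add, Pi.add_apply, suppEmb_apply (hA.add hB) (hA'.add hB'), suppEmb_apply hA hA',
    suppEmb_apply hB hB', suppFn_add _ hA hA' hB hB']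

theorem suppEmb_smul (hA : A.Nonempty) (hA' : Bornology.IsBounded A) {c : ℝ} (hc : 0 ≤ c) :
    suppEmb (c • A) = c • suppEmb A := by
  ext s
  rw [lp.coeFn_smul, Pi.smul_apply, suppEmb_apply hA.smul_set (hA'.smul₀ c), suppEmb_apply hA hA',
    suppFn_smul _ hc, smul_eq_mul]

/-- The Hausdorff distance is the uniform distance of the support functions. -/
theorem hausdorffDist_eq_norm_suppEmb_sub (hA : IsCWK X A) (hB : IsCWK X B) :
    hausdorffDist A B = ‖suppEmb A - suppEmb B‖ := by
  have hA' := hA.isBounded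
  have hB' := hB.isBounded
  refine le_antisymm ?_ (SuppSpace.norm_le fun s => ?_)
  · have key : ∀ {A B : Set X}, IsCWK X A → IsCWK X B → ∀ x ∈ A,
        infDist x B ≤ ‖suppEmb A - suppEmb B‖ := by
      intro A B hA hB x hx
      refine infDist_le_of_forall_le_suppFn hB.1 hB.2.1 (norm_nonneg _)
        fun x' hx' => ?_
      have h1 := SuppSpace.abs_le (suppEmb A - suppEmb B) ⟨x', hx'⟩
      rw [lp.coeFn_sub, Pi.sub_apply, suppEmb_apply hA.1 hA.isBounded,
        suppEmb_apply hB.1 hB.isBounded] at h1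
      linarith [le_suppFn x' hA.isBounded hx, le_of_abs_le h1]
    exact hausdorffDist_le_of_infDist (norm_nonneg _) (key hA hB)
      (norm_sub_rev (suppEmb A) (suppEmb B) ▸ key hB hA)
  · have key : ∀ {A B : Set X}, IsCWK X A → IsCWK X B →
        suppFn s.1 A ≤ suppFn s.1 B + hausdorffDist A B := by
      intro A B hA hB
      refine suppFn_le _ hA.1 fun a ha => le_of_forall_pos_le_add fun η hη => ?_
      obtain ⟨b, hb, hab⟩ := exists_dist_lt_of_hausdorffDist_lt ha
        (show hausdorffDist A B < hausdorffDist A B + η by linarith)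
        (hausdorffEDist_ne_top_of_nonempty_of_bounded hA.1 hB.1 hA.isBounded hB.isBounded)
      have h1 := le_suppFn s.1 hB.isBounded hb
      have h2 : s.1 (a - b) ≤ dist a b := by
        rw [dist_eq_norm]
        exact (le_abs_self _).trans ((s.1.le_of_opNorm_le s.2 _).trans (one_mul _).le)
      rw [map_sub] at h2
      linarith
    rw [lp.coeFn_sub, Pi.sub_apply, suppEmb_apply hA.1 hA', suppEmb_apply hB.1 hB', abs_le]
    have h1 := key hA hB
    have h2 := key hB hA
    rw [hausdorffDist_comm] at h2
    constructor <;> linarith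

variable (X) in
/-- The isometric embedding of `X` into the bounded functions on the dual unit ball. -/
noncomputable def pointEmb : X →L[ℝ] SuppSpace X :=
  LinearMap.mkContinuous
    { toFun := fun x => ⟨fun s => s.1 x, memℓp_infty ⟨‖x‖, by
        rintro _ ⟨s, rfl⟩
        exact (s.1.le_of_opNorm_le s.2 x).trans (one_mul _).le⟩⟩
      map_add' := fun x y => by ext s; exact map_add s.1 x y
      map_smul' := fun c x => by ext s; exact map_smul s.1 c x } 1
    fun x => by
      rw [one_mul]
      exact SuppSpace.norm_le fun s => (s.1.le_of_opNorm_le s.2 x).trans (one_mul _).le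

@[simp]
theorem pointEmb_apply (x : X) (s : {x' : X →L[ℝ] ℝ // ‖x'‖ ≤ 1}) : pointEmb X x s = s.1 x := rfl

theorem norm_pointEmb_le (x : X) : ‖pointEmb X x‖ ≤ ‖x‖ :=
  ((pointEmb X).le_of_opNorm_le (LinearMap.mkContinuous_norm_le _ zero_le_one _) _).trans
    (one_mul _).le

theorem suppEmb_singleton (x : X) : suppEmb {x} = pointEmb X x := by
  ext s
  rw [suppEmb_apply (singleton_nonempty x) Bornology.isBounded_singleton, suppFn_singleton,
    pointEmb_apply]

theorem norm_le_of_forall_apply_le {x : X} {c : ℝ}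
    (h : ∀ s : {x' : X →L[ℝ] ℝ // ‖x'‖ ≤ 1}, s.1 x ≤ c) : ‖x‖ ≤ c := by
  obtain ⟨f, hf, hfx⟩ := exists_dual_vector'' ℝ x
  simpa [hfx] using h ⟨f, hf⟩

end Support

section Selections

variable {X : Type*} [NormedAddCommGroup X] [NormedSpace ℝ X]

theorem infDist_le_norm_suppEmb_sub {A B : Set X} (hA : IsCWK X A) (hB : IsCWK X B) {x : X}
    (hx : x ∈ A) : infDist x B ≤ ‖suppEmb A - suppEmb B‖ := by
  rw [← hausdorffDist_eq_norm_suppEmb_sub hA hB]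
  exact infDist_le_hausdorffDist_of_mem hx
    (hausdorffEDist_ne_top_of_nonempty_of_bounded hA.1 hB.1 hA.isBounded hB.isBounded)

/-- A measurable multifunction with convex weakly compact values has a measurable selection. -/
theorem exists_aestronglyMeasurable_selection [CompleteSpace X] {Γ : ℝ → Set X}
    (hΓ : ∀ t ∈ Icc (0:ℝ) 1, IsCWK X (Γ t))
    (hg : AEStronglyMeasurable (fun t => suppEmb (Γ t)) (volume.restrict (Icc 0 1))) :
    ∃ f : ℝ → X, Selection Γ f ∧ AEStronglyMeasurable f (volume.restrict (Icc 0 1)) := by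
  obtain ⟨g', hg', hae⟩ := hg
  have hgood : ∀ᵐ t ∂volume.restrict (Icc (0:ℝ) 1), t ∈ Icc (0:ℝ) 1 ∧ suppEmb (Γ t) = g' t :=
    (ae_restrict_mem measurableSet_Icc).and hae
  set S : Set (SuppSpace X) := g' '' {t | t ∈ Icc (0:ℝ) 1 ∧ suppEmb (Γ t) = g' t} with hS
  have hSne : S.Nonempty := by
    have : (ae (volume.restrict (Icc (0:ℝ) 1))).NeBot := by
      rw [ae_neBot, Ne, Measure.restrict_eq_zero]
      simp
    exact hgood.exists.elim fun t ht => ⟨_, t, ht, rfl⟩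
  obtain ⟨D, hDS, hDc, hSD⟩ := (hg'.isSeparable_range.mono
    (image_subset_range g' _)).exists_countable_dense_subset (s := S)
  have hDne : D.Nonempty := by
    rw [← closure_nonempty_iff]
    exact hSne.mono hSD
  obtain ⟨y, rfl⟩ := hDc.exists_eq_range hDne
  choose σ hσ hσy using fun n => hDS (mem_range_self n)
  have hpow : ∀ k : ℕ, (0:ℝ) < (1 / 2) ^ k := fun k => by positivity
  choose u hum hu using fun k : ℕ => exists_measurable_index (α := ℝ)
    (p := fun t m => ‖g' t - y m‖ < (1 / 2) ^ k) fun m =>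
      measurableSet_lt (hg'.sub stronglyMeasurable_const).norm.measurable measurable_const
  have huk : ∀ t, (t ∈ Icc (0:ℝ) 1 ∧ suppEmb (Γ t) = g' t) → ∀ k,
      ‖suppEmb (Γ t) - suppEmb (Γ (σ (u k t)))‖ < (1 / 2) ^ k := by
    intro t ht k
    rw [(hσ _).2, hσy, ht.2]
    refine hu k t ?_
    obtain ⟨_, ⟨m, rfl⟩, hm⟩ := Metric.mem_closure_iff.1 (hSD (mem_image_of_mem g' ht)) _ (hpow k)
    exact ⟨m, by rwa [← dist_eq_norm]⟩
  have hc : ∀ (k : ℕ) (x : X) (n : ℕ), ∃ z ∈ Γ (σ n),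
      dist x z < infDist x (Γ (σ n)) + (1 / 2) ^ k :=
    fun k x n => (infDist_lt_iff (hΓ _ (hσ n).1).1).1 (lt_add_of_pos_right _ (hpow k))
  choose c hcΓ hcd using hc
  let φ : ℕ → ℝ → X := fun k => Nat.rec (fun t => c 0 0 (u 0 t))
    (fun k φk t => c k (φk t) (u (k + 1) t)) k
  have hφΓ : ∀ k t, φ k t ∈ Γ (σ (u k t)) := by
    rintro (_ | k) t
    · exact hcΓ _ _ _
    · exact hcΓ _ _ _
  have hφm : ∀ k, ∃ (q : ℝ → ℕ) (v : ℕ → X), Measurable q ∧ φ k = fun t => v (q t) := by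
    intro k
    induction k with
    | zero => exact ⟨u 0, c 0 0, hum 0, rfl⟩
    | succ k ih =>
      obtain ⟨q, v, hq, hv⟩ := ih
      refine ⟨fun t => Nat.pair (q t) (u (k + 1) t),
        fun m => c k (v m.unpair.1) m.unpair.2,
        (measurable_of_countable (Function.uncurry Nat.pair)).comp (hq.prodMk (hum _)), ?_⟩
      funext t
      change c k (φ k t) (u (k + 1) t) = _
      simp [hv]
  have hφsm : ∀ k, StronglyMeasurable (φ k) := by
    intro k
    obtain ⟨q, v, hq, hv⟩ := hφm k
    rw [hv]
    exact (StronglyMeasurable.of_discrete (f := v)).comp_measurable hq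
  have hlim : ∀ t, (t ∈ Icc (0:ℝ) 1 ∧ suppEmb (Γ t) = g' t) →
      ∃ x ∈ Γ t, Tendsto (fun k => φ k t) atTop (𝓝 x) := by
    intro t ht
    have hcauchy : CauchySeq fun k => φ k t := by
      refine cauchySeq_of_le_geometric (1 / 2) 3 (by norm_num) fun k => ?_
      have h1 : dist (φ k t) (φ (k + 1) t)
          < infDist (φ k t) (Γ (σ (u (k + 1) t))) + (1 / 2) ^ k := hcd _ _ _
      have h2 := infDist_le_norm_suppEmb_sub (hΓ _ (hσ (u k t)).1) (hΓ _ (hσ (u (k + 1) t)).1)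
        (hφΓ k t)
      have h3 := huk t ht k
      have h4 := huk t ht (k + 1)
      have h5 := norm_sub_le_norm_sub_add_norm_sub (suppEmb (Γ (σ (u k t)))) (suppEmb (Γ t))
        (suppEmb (Γ (σ (u (k + 1) t))))
      rw [norm_sub_rev] at h3
      have h6 : ((1:ℝ) / 2) ^ (k + 1) ≤ (1 / 2) ^ k := by
        rw [pow_succ]
        linarith [hpow k]
      linarith
    obtain ⟨x, hx⟩ := cauchySeq_tendsto_of_complete hcauchy
    refine ⟨x, ?_, hx⟩
    have hcwk := hΓ t ht.1
    rw [hcwk.isClosed.mem_iff_infDist_zero hcwk.1]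
    refine le_antisymm ?_ infDist_nonneg
    refine le_of_tendsto_of_tendsto' (((continuous_infDist_pt (Γ t)).tendsto x).comp hx)
      (tendsto_pow_atTop_nhds_zero_of_lt_one (by norm_num) (by norm_num : (1:ℝ) / 2 < 1))
      fun k => ?_
    have h3 := huk t ht k
    rw [norm_sub_rev] at h3
    exact (infDist_le_norm_suppEmb_sub (hΓ _ (hσ _).1) hcwk (hφΓ k t)).trans h3.le
  have hsel : ∀ t, ∃ x, (t ∈ Icc (0:ℝ) 1 → x ∈ Γ t) ∧
      ((t ∈ Icc (0:ℝ) 1 ∧ suppEmb (Γ t) = g' t) → Tendsto (fun k => φ k t) atTop (𝓝 x)) := by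
    intro t
    by_cases ht : t ∈ Icc (0:ℝ) 1 ∧ suppEmb (Γ t) = g' t
    · exact (hlim t ht).imp fun x hx => ⟨fun _ => hx.1, fun _ => hx.2⟩
    · by_cases ht' : t ∈ Icc (0:ℝ) 1
      · exact (hΓ t ht').1.imp fun x hx => ⟨fun _ => hx, fun h => absurd h ht⟩
      · exact ⟨0, fun h => absurd h ht', fun h => absurd h ht⟩
  choose f hf hftend using hsel
  exact ⟨f, hf, aestronglyMeasurable_of_tendsto_ae atTop
    (fun k => (hφsm k).aestronglyMeasurable) (hgood.mono hftend)⟩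

end Selections

section Truncation

variable {Z W : Type*} [NormedAddCommGroup Z] [NormedAddCommGroup W]

/-- The truncation of `h` to the points where `g` is bounded by `k`. -/
noncomputable def trunc (g : ℝ → W) (h : ℝ → Z) (k : ℕ) : ℝ → Z :=
  {t | ‖g t‖ ≤ k}.indicator h

theorem trunc_of_le {g : ℝ → W} {h : ℝ → Z} {k : ℕ} {t : ℝ} (ht : ‖g t‖ ≤ k) :
    trunc g h k t = h t :=
  indicator_of_mem (s := {t | ‖g t‖ ≤ k}) ht h

theorem trunc_of_not_le {g : ℝ → W} {h : ℝ → Z} {k : ℕ} {t : ℝ} (ht : ¬ ‖g t‖ ≤ k) :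
    trunc g h k t = 0 :=
  indicator_of_notMem (s := {t | ‖g t‖ ≤ k}) ht h

theorem integrableOn_trunc {g : ℝ → W} {h : ℝ → Z} {C : ℝ}
    (hg : AEStronglyMeasurable g (volume.restrict (Icc 0 1)))
    (hh : AEStronglyMeasurable h (volume.restrict (Icc 0 1)))
    (hC : ∀ t ∈ Icc (0:ℝ) 1, ‖h t‖ ≤ C * ‖g t‖) (k : ℕ) :
    IntegrableOn (trunc g h k) (Icc 0 1) := by
  have hset : NullMeasurableSet {t | ‖g t‖ ≤ k} (volume.restrict (Icc 0 1)) :=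
    nullMeasurableSet_le hg.norm.aemeasurable aemeasurable_const
  refine Integrable.of_bound (hh.indicator₀ hset) (|C| * k) ?_
  filter_upwards [ae_restrict_mem measurableSet_Icc] with t ht
  by_cases hk : ‖g t‖ ≤ k
  · rw [trunc_of_le hk]
    exact (hC t ht).trans (mul_le_mul (le_abs_self C) hk (norm_nonneg _) (abs_nonneg _))
  · rw [trunc_of_not_le hk, norm_zero]
    positivity

end Truncation

section SuppSpaceIntegral

variable {X : Type*} [NormedAddCommGroup X] [NormedSpace ℝ X]

theorem SuppSpace.integral_apply_mono {u v : ℝ → SuppSpace X} (hu : IntegrableOn u (Icc 0 1))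
    (hv : IntegrableOn v (Icc 0 1)) {s : {x' : X →L[ℝ] ℝ // ‖x'‖ ≤ 1}}
    (huv : ∀ x ∈ Icc (0:ℝ) 1, u x s ≤ v x s) {a b : ℝ} (ha : 0 ≤ a) (hab : a ≤ b) (hb : b ≤ 1) :
    (∫ x in a..b, u x) s ≤ (∫ x in a..b, v x) s := by
  have hsub : Ioc a b ⊆ Icc 0 1 := fun x hx => ⟨ha.trans hx.1.le, hx.2.trans hb⟩
  have hu' := hu.mono_set hsub
  have hv' := hv.mono_set hsub
  let e := lp.evalCLM ℝ (fun _ : {x' : X →L[ℝ] ℝ // ‖x'‖ ≤ 1} => ℝ) ∞ s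
  rw [intervalIntegral.integral_of_le hab, intervalIntegral.integral_of_le hab]
  change e _ ≤ e _
  rw [← e.integral_comp_comm hu', ← e.integral_comp_comm hv']
  exact setIntegral_mono_on (e.integrable_comp hu') (e.integrable_comp hv') measurableSet_Ioc
    fun x hx => huv x (hsub hx)

theorem SuppSpace.integral_apply_nonneg {v : ℝ → SuppSpace X}
    (hv : IntegrableOn v (Icc 0 1)) {s : {x' : X →L[ℝ] ℝ // ‖x'‖ ≤ 1}}
    (h : ∀ x ∈ Icc (0:ℝ) 1, 0 ≤ v x s) {a b : ℝ} (ha : 0 ≤ a) (hab : a ≤ b) (hb : b ≤ 1) :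
    0 ≤ (∫ x in a..b, v x) s := by
  have := SuppSpace.integral_apply_mono (u := fun _ => 0) integrableOn_zero hv h ha hab hb
  simpa using this

theorem SuppSpace.trunc_apply_nonneg {W : Type*} [NormedAddCommGroup W] {g : ℝ → W}
    {h : ℝ → SuppSpace X} {s : {x' : X →L[ℝ] ℝ // ‖x'‖ ≤ 1}} {t : ℝ} (ht : 0 ≤ h t s) (k : ℕ) :
    0 ≤ trunc g h k t s := by
  by_cases hk : ‖g t‖ ≤ k
  · rwa [trunc_of_le hk]
  · rw [trunc_of_not_le hk]
    exact le_rfl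

theorem SuppSpace.trunc_apply_le {W : Type*} [NormedAddCommGroup W] {g : ℝ → W}
    {h : ℝ → SuppSpace X} {s : {x' : X →L[ℝ] ℝ // ‖x'‖ ≤ 1}} {t : ℝ} (ht : 0 ≤ h t s) (k : ℕ) :
    trunc g h k t s ≤ h t s := by
  by_cases hk : ‖g t‖ ≤ k
  · rw [trunc_of_le hk]
  · rw [trunc_of_not_le hk]
    exact ht

theorem SuppSpace.trunc_apply_mono {W : Type*} [NormedAddCommGroup W] {g : ℝ → W}
    {h : ℝ → SuppSpace X} {s : {x' : X →L[ℝ] ℝ // ‖x'‖ ≤ 1}} {t : ℝ} (ht : 0 ≤ h t s) {k n : ℕ}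
    (hkn : k ≤ n) : trunc g h k t s ≤ trunc g h n t s := by
  by_cases hk : ‖g t‖ ≤ k
  · rw [trunc_of_le hk, trunc_of_le (hk.trans (Nat.cast_le.2 hkn))]
  · rw [trunc_of_not_le hk]
    exact SuppSpace.trunc_apply_nonneg ht n

end SuppSpaceIntegral

theorem integral_sub_integral_of_integrableOn {Z : Type*} [NormedAddCommGroup Z] [NormedSpace ℝ Z]
    {u : ℝ → Z} (hu : IntegrableOn u (Icc 0 1)) {a b : ℝ} (ha : 0 ≤ a) (hab : a ≤ b)
    (hb : b ≤ 1) : (∫ x in (0:ℝ)..b, u x) - ∫ x in (0:ℝ)..a, u x = ∫ x in a..b, u x := by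
  have h : ∀ c, 0 ≤ c → c ≤ 1 → IntervalIntegrable u volume 0 c := fun c h0 h1 =>
    (intervalIntegrable_iff_integrableOn_Icc_of_le h0).2 (hu.mono_set (Icc_subset_Icc_right h1))
  exact intervalIntegral.integral_interval_sub_left (h b (ha.trans hab) hb)
    (h a ha (hab.trans hb))

theorem continuousOn_primitive_of_integrableOn {Z : Type*} [NormedAddCommGroup Z] [NormedSpace ℝ Z]
    {u : ℝ → Z} (hu : IntegrableOn u (Icc 0 1)) :
    ContinuousOn (fun x => ∫ y in (0:ℝ)..x, u y) (Icc 0 1) := by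
  have := intervalIntegral.continuousOn_primitive_interval (a := (0:ℝ)) (b := 1) (f := u)
    (by rwa [uIcc_of_le zero_le_one])
  rwa [uIcc_of_le zero_le_one] at this

section Primitive

variable {X : Type*} [NormedAddCommGroup X] [NormedSpace ℝ X]

/-- Riemann sums of `f` along a single fine Perron partition, as step functions: `r` rounds down to
the partition points. -/
theorem exists_step_primitive {ι : Type*} {δ : ℝ → ℝ} (hδ : IsGauge δ) {η : ℝ}
    (hη : ∀ t, δ t ≤ η) {f : ℝ → X} {e : ι → X →L[ℝ] ℝ} {U : ι → ℝ → ℝ}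
    (h : ∀ c d t, 0 ≤ c → c ≤ t → t ≤ d → d ≤ 1 → t - δ t < c → d < t + δ t →
      ∀ s, e s ((d - c) • f t) ≤ U s d - U s c) :
    ∃ (φ : ℝ → X) (r : ℝ → ℝ), φ 0 = 0 ∧ r 0 = 0 ∧
      (∀ y ∈ Icc (0:ℝ) 1, 0 ≤ r y ∧ r y ≤ y ∧ y ≤ r y + 2 * η) ∧ MonotoneOn r (Icc 0 1) ∧
      ∀ s, MonotoneOn (fun y => U s (r y) - e s (φ y)) (Icc 0 1) := by
  have hη0 : 0 ≤ η := (hδ 0 ⟨le_rfl, zero_le_one⟩).le.trans (hη 0)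
  suffices H : ∃ (φ : ℝ → X) (r : ℝ → ℝ), (φ 0 = 0 ∧ r 0 = 0) ∧ r 1 = 1 ∧
      (∀ y ∈ Icc (0:ℝ) 1, 0 ≤ r y ∧ r y ≤ y ∧ y ≤ r y + 2 * η) ∧ MonotoneOn r (Icc 0 1) ∧
      ∀ s, MonotoneOn (fun y => U s (r y) - e s (φ y)) (Icc 0 1) by
    obtain ⟨φ, r, h0, -, h1⟩ := H
    exact ⟨φ, r, h0.1, h0.2, h1⟩
  refine cousin_induction hδ le_rfl (a := 0) (Q := fun x => ∃ (φ : ℝ → X) (r : ℝ → ℝ),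
      (φ 0 = 0 ∧ r 0 = 0) ∧ r x = x ∧
      (∀ y ∈ Icc (0:ℝ) x, 0 ≤ r y ∧ r y ≤ y ∧ y ≤ r y + 2 * η) ∧ MonotoneOn r (Icc 0 x) ∧
      ∀ s, MonotoneOn (fun y => U s (r y) - e s (φ y)) (Icc 0 x)) ?_ ?_ zero_le_one le_rfl
  · refine ⟨fun _ => 0, fun _ => 0, ⟨rfl, rfl⟩, rfl, fun y hy => ⟨le_rfl, hy.1, ?_⟩, ?_, ?_⟩
    · linarith [hy.2]
    · exact fun _ _ _ _ _ => le_rfl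
    · exact fun _ _ _ _ _ _ => le_rfl
  · rintro c d t hc0 hct htd hd1 h1 h2 ⟨φ, r, ⟨hφ0, hr0⟩, hrc, hr, hrm, hm⟩
    have hcd : c ≤ d := hct.trans htd
    refine ⟨fun y => if y ≤ c then φ y else if y < d then φ c else φ c + (d - c) • f t,
      fun y => if y ≤ c then r y else if y < d then c else d, by simp [hc0, hφ0, hr0], ?_, ?_, ?_,
      ?_⟩
    · rcases hcd.eq_or_lt with rfl | hlt
      · simpa using hrc
      · simp [hlt]
    · intro y hy
      dsimp only
      split_ifs with h3 h4
      · exact hr y ⟨hy.1, h3⟩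
      · exact ⟨hc0, (not_le.1 h3).le, by linarith [hη t]⟩
      · exact ⟨hc0.trans hcd, not_lt.1 h4, by linarith [hy.2]⟩
    · intro x hx y hy hxy
      dsimp only
      have hc' : ∀ x, 0 ≤ x → x ≤ c → r x ≤ c := fun x h0 hx => (hr x ⟨h0, hx⟩).2.1.trans hx
      split_ifs with h3 h4 h5 h6 h7 h8 <;>
        first
        | exact hrm ⟨hx.1, by assumption⟩ ⟨hy.1, by assumption⟩ hxy
        | linarith [hc' x hx.1 (by assumption)]
        | linarith
    · intro s x hx y hy hxy
      have hstep := h c d t hc0 hct htd hd1 h1 h2 s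
      have hc' : ∀ x, 0 ≤ x → x ≤ c → U s (r x) - e s (φ x) ≤ U s c - e s (φ c) := fun x h0 hx => by
        have := hm s ⟨h0, hx⟩ ⟨hc0, le_rfl⟩ hx
        simpa only [hrc] using this
      dsimp only
      split_ifs with h3 h4 h5 h6 h7 h8 <;>
        first
        | exact hm s ⟨hx.1, by assumption⟩ ⟨hy.1, by assumption⟩ hxy
        | (rw [map_add]; linarith [hc' x hx.1 (by assumption)])
        | linarith [hc' x hx.1 (by assumption)]
        | (rw [map_add]; linarith)
        | linarith

end Primitive

section WeakLimit

variable {X : Type*} [NormedAddCommGroup X] [NormedSpace ℝ X]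

/-- Points approaching a weakly compact set have a common weak cluster point in it. -/
theorem IsCWK.exists_tendsto_apply {A : Set X} (hA : IsCWK X A) {ι : Type*} (𝒰 : Ultrafilter ι)
    {x : ι → X} (hx : Tendsto (fun i => infDist (x i) A) 𝒰 (𝓝 0)) :
    ∃ a ∈ A, ∀ x' : X →L[ℝ] ℝ, Tendsto (fun i => x' (x i)) 𝒰 (𝓝 (x' a)) := by
  have hz : ∀ i, ∃ z ∈ A, dist (x i) z ≤ 2 * infDist (x i) A := by
    intro i
    rcases (infDist_nonneg (x := x i) (s := A)).eq_or_lt' with h0 | h0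
    · exact ⟨x i, (hA.isClosed.mem_iff_infDist_zero hA.1).2 h0, by simp [h0]⟩
    · obtain ⟨z, hz, hlt⟩ := (infDist_lt_iff hA.1).1 (lt_two_mul_self h0)
      exact ⟨z, hz, hlt.le⟩
  choose z hzA hz using hz
  obtain ⟨_, ⟨a, ha, rfl⟩, hlim⟩ := hA.2.2.ultrafilter_le_nhds
    (𝒰.map fun i => toWeakSpace ℝ X (z i))
    (le_principal_iff.2 (mem_map.2 (univ_mem' fun i => mem_image_of_mem _ (hzA i))))
  refine ⟨a, ha, fun x' => ?_⟩
  have h1 : Tendsto (fun i => x' (z i)) 𝒰 (𝓝 (x' a)) := by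
    have := ((continuous_toWeakSpace_symm_apply x').tendsto (toWeakSpace ℝ X a)).comp
      (show Tendsto (fun i => toWeakSpace ℝ X (z i)) 𝒰 (𝓝 (toWeakSpace ℝ X a)) from hlim)
    simpa [Function.comp_def] using this
  have h2 : Tendsto (fun i => x' (x i - z i)) 𝒰 (𝓝 0) := by
    refine squeeze_zero_norm (fun i => (x'.le_opNorm _).trans ?_)
      (by simpa using hx.const_mul (‖x'‖ * 2))
    rw [mul_assoc, ← dist_eq_norm]
    exact mul_le_mul_of_nonneg_left (hz i) (norm_nonneg _)
  simpa using h1.add h2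

theorem integrableOn_trunc_sub_pointEmb {g : ℝ → SuppSpace X} {f : ℝ → X}
    (hg : AEStronglyMeasurable g (volume.restrict (Icc 0 1)))
    (hf : AEStronglyMeasurable f (volume.restrict (Icc 0 1)))
    (hfg : ∀ t ∈ Icc (0:ℝ) 1, ∀ s, s.1 (f t) ≤ g t s) (k : ℕ) :
    IntegrableOn (trunc g (fun t => g t - pointEmb X (f t)) k) (Icc 0 1) := by
  refine integrableOn_trunc hg
    (hg.sub ((pointEmb X).continuous.comp_aestronglyMeasurable hf)) (C := 2) (fun t ht => ?_) k
  have h1 := norm_pointEmb_le (f t)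
  have h2 : ‖f t‖ ≤ ‖g t‖ := norm_le_of_forall_apply_le fun s =>
    (hfg t ht s).trans ((le_abs_self _).trans (SuppSpace.abs_le _ s))
  exact (norm_sub_le _ _).trans (by linarith)

/-- A weak limit of Riemann sums of `f` gives a function whose increments are dominated by those of
the primitive `F` of `g`, even after removing the integrals of the truncations of `g - f`. -/
theorem exists_weak_limit_primitive {g F : ℝ → SuppSpace X} {f : ℝ → X} {K : ℝ → Set X}
    (hK : ∀ x ∈ Icc (0:ℝ) 1, IsCWK X (K x)) (hF : ∀ x ∈ Icc (0:ℝ) 1, F x = suppEmb (K x))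
    (hF0 : F 0 = 0) (hvar : VarHenstock g F)
    (hf : AEStronglyMeasurable f (volume.restrict (Icc 0 1)))
    (hfg : ∀ t ∈ Icc (0:ℝ) 1, ∀ s, s.1 (f t) ≤ g t s) :
    ∃ φ : ℝ → X, ∀ (k : ℕ) (a b : ℝ), 0 ≤ a → a ≤ b → b ≤ 1 → ∀ s,
      s.1 (φ b - φ a)
        ≤ (F b - F a - ∫ x in a..b, trunc g (fun t => g t - pointEmb X (f t)) k x) s := by
  have hg := hvar.aestronglyMeasurable
  have hFc := hvar.continuousOn
  set γ : ℝ → SuppSpace X := fun t => g t - pointEmb X (f t) with hγ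
  have hγ0 : ∀ t ∈ Icc (0:ℝ) 1, ∀ s, 0 ≤ γ t s := fun t ht s => sub_nonneg.2 (hfg t ht s)
  have hinteg : ∀ k, IntegrableOn (trunc g γ k) (Icc 0 1) :=
    integrableOn_trunc_sub_pointEmb hg hf hfg
  set H : ℕ → ℝ → SuppSpace X := fun k x => ∫ y in (0:ℝ)..x, trunc g γ k y with hH
  have hHsub : ∀ k a b, 0 ≤ a → a ≤ b → b ≤ 1 → H k b - H k a = ∫ x in a..b, trunc g γ k x :=
    fun k a b ha hab hb => integral_sub_integral_of_integrableOn (hinteg k) ha hab hb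
  have happrox : ∀ n : ℕ, ∃ (φ : ℝ → X) (r W : ℝ → ℝ), φ 0 = 0 ∧ r 0 = 0 ∧
      (∀ y ∈ Icc (0:ℝ) 1, 0 ≤ r y ∧ r y ≤ y ∧ y ≤ r y + 2 * (1 / (n + 1))) ∧
      MonotoneOn r (Icc 0 1) ∧ Monotone W ∧ W 1 - W 0 ≤ 2 * (1 / (n + 1)) ∧
      ∀ s : {x' : X →L[ℝ] ℝ // ‖x'‖ ≤ 1},
        MonotoneOn (fun y => (F (r y) s - H n (r y) s + W (r y)) - s.1 (φ y)) (Icc 0 1) := by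
    intro n
    have hn : (0:ℝ) < 1 / (n + 1) := by positivity
    obtain ⟨δ, V, hV, -, -⟩ := hvar _ hn
    obtain ⟨δ', V', hδ', -, hV'm, hV', hV'b⟩ := exists_free_control hinteg hn
    obtain ⟨φ, r, h1, h2, h3, h4, h5⟩ := exists_step_primitive (η := 1 / ((n : ℝ) + 1))
      (δ := fun t => min (min (δ t) (δ' n t)) (1 / (n + 1))) (f := f)
      (e := fun s : {x' : X →L[ℝ] ℝ // ‖x'‖ ≤ 1} => s.1)
      (U := fun s p => F p s - H n p s + (V p + V' p))
      (fun t ht => lt_min (lt_min (hV.gauge t ht) (hδ' n t)) hn) (fun t => min_le_right _ _) (by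
        intro c d t hc hct htd hd hl hr s
        have hmin1 : min (min (δ t) (δ' n t)) (1 / ((n:ℝ) + 1)) ≤ δ t :=
          (min_le_left _ _).trans (min_le_left _ _)
        have hmin2 : min (min (δ t) (δ' n t)) (1 / ((n:ℝ) + 1)) ≤ δ' n t :=
          (min_le_left _ _).trans (min_le_right _ _)
        have ht : t ∈ Icc (0:ℝ) 1 := ⟨hc.trans hct, htd.trans hd⟩
        have b1 := (SuppSpace.abs_le _ s).trans
          (hV.bound c d t hc hct htd hd (by linarith) (by linarith))
        have b2 := (SuppSpace.abs_le _ s).trans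
          (hV'b n c d t hc (hct.trans htd) hd (by linarith) (by linarith))
        rw [← hHsub n c d hc (hct.trans htd) hd] at b2
        have b3 : trunc g γ n t s ≤ γ t s := SuppSpace.trunc_apply_le (hγ0 t ht s) n
        have b4 : γ t s = g t s - s.1 (f t) := rfl
        simp only [lp.coeFn_sub, lp.coeFn_smul, Pi.sub_apply, Pi.smul_apply, smul_eq_mul] at b1 b2
        rw [map_smul, smul_eq_mul]
        have b5 := neg_le_of_abs_le b1
        have b6 := le_of_abs_le b2
        have b7 := mul_le_mul_of_nonneg_left b3 (sub_nonneg.2 (hct.trans htd))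
        rw [b4, mul_sub] at b7
        linarith)
    exact ⟨φ, r, fun p => V p + V' p, h1, h2, h3, h4, hV.mono.add hV'm,
      by linarith [hV.total], h5⟩
  choose φ r W hφ0 hr0 hr hrm hW hW1 hmono using happrox
  have hrmem : ∀ n, ∀ x ∈ Icc (0:ℝ) 1, r n x ∈ Icc (0:ℝ) 1 := fun n x hx =>
    ⟨(hr n x hx).1, (hr n x hx).2.1.trans hx.2⟩
  have hη : Tendsto (fun n : ℕ => 2 * (1 / ((n:ℝ) + 1))) atTop (𝓝 0) := by
    simpa using (tendsto_one_div_add_atTop_nhds_zero_nat (𝕜 := ℝ)).const_mul 2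
  have hrlim : ∀ x ∈ Icc (0:ℝ) 1, Tendsto (fun n => r n x) atTop (𝓝[Icc 0 1] x) := by
    intro x hx
    refine tendsto_nhdsWithin_iff.2 ⟨?_, Eventually.of_forall fun n => hrmem n x hx⟩
    refine tendsto_of_tendsto_of_tendsto_of_le_of_le (g := fun n : ℕ => x - 2 * (1 / ((n:ℝ) + 1)))
      (by simpa only [sub_zero] using hη.const_sub x)
      tendsto_const_nhds (fun n => ?_) fun n => (hr n x hx).2.1
    have := (hr n x hx).2.2
    linarith
  have hinc : ∀ n a b, 0 ≤ a → a ≤ b → b ≤ 1 → ∀ s, s.1 (φ n b) - s.1 (φ n a) ≤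
      F (r n b) s - F (r n a) s - (H n (r n b) s - H n (r n a) s) + 2 * (1 / ((n:ℝ) + 1)) := by
    intro n a b ha hab hb s
    have ha' : a ∈ Icc (0:ℝ) 1 := ⟨ha, hab.trans hb⟩
    have hb' : b ∈ Icc (0:ℝ) 1 := ⟨ha.trans hab, hb⟩
    have h1 := hmono n s ha' hb' hab
    have h2 := hW n (hrmem n b hb').2
    have h3 := hW n (hrmem n a ha').1
    have h4 := hW1 n
    simp only at h1
    linarith
  have hdist : ∀ x ∈ Icc (0:ℝ) 1, Tendsto (fun n => infDist (φ n x) (K x)) atTop (𝓝 0) := by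
    intro x hx
    have hlim : Tendsto (fun n => ‖F (r n x) - F x‖ + 2 * (1 / ((n:ℝ) + 1))) atTop (𝓝 0) := by
      simpa using ((((hFc x hx).tendsto.comp (hrlim x hx)).sub_const (F x)).norm).add hη
    refine squeeze_zero (fun _ => infDist_nonneg) (fun n => ?_) hlim
    refine infDist_le_of_forall_le_suppFn (hK x hx).1 (hK x hx).2.1 (by positivity)
      fun x' hx' => ?_
    have h1 := hinc n 0 x le_rfl hx.1 hx.2 ⟨x', hx'⟩
    have h2 := (hHsub n 0 (r n x) le_rfl (hrmem n x hx).1 (hrmem n x hx).2)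
    have h3 := SuppSpace.integral_apply_nonneg (hinteg n) (s := ⟨x', hx'⟩)
      (fun t ht => SuppSpace.trunc_apply_nonneg (hγ0 t ht _) n) le_rfl (hrmem n x hx).1
      (hrmem n x hx).2
    have h4 := (le_abs_self _).trans (SuppSpace.abs_le (F (r n x) - F x) ⟨x', hx'⟩)
    have h5 : H n 0 = 0 := intervalIntegral.integral_same
    rw [← h2, h5, sub_zero] at h3
    rw [← suppEmb_apply (hK x hx).1 (hK x hx).isBounded ⟨x', hx'⟩, ← hF x hx]
    rw [lp.coeFn_sub, Pi.sub_apply] at h4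
    rw [hr0, hφ0, hF0, h5, map_zero, lp.coeFn_zero, Pi.zero_apply] at h1
    simp only at h1 ⊢
    linarith
  have hφ : ∀ x, ∃ y, x ∈ Icc (0:ℝ) 1 → ∀ x' : X →L[ℝ] ℝ,
      Tendsto (fun n => x' (φ n x)) (hyperfilter ℕ) (𝓝 (x' y)) := by
    intro x
    by_cases hx : x ∈ Icc (0:ℝ) 1
    · obtain ⟨y, -, hy⟩ := (hK x hx).exists_tendsto_apply (hyperfilter ℕ)
        ((hdist x hx).mono_left Nat.hyperfilter_le_atTop)
      exact ⟨y, fun _ => hy⟩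
    · exact ⟨0, fun h => absurd h hx⟩
  choose φ' hφ' using hφ
  refine ⟨φ', fun k a b ha hab hb s => ?_⟩
  have ha' : a ∈ Icc (0:ℝ) 1 := ⟨ha, hab.trans hb⟩
  have hb' : b ∈ Icc (0:ℝ) 1 := ⟨ha.trans hab, hb⟩
  have happly : ∀ {u : ℝ → SuppSpace X}, ContinuousOn u (Icc 0 1) → ∀ x ∈ Icc (0:ℝ) 1,
      Tendsto (fun n => u (r n x) s) (hyperfilter ℕ) (𝓝 (u x s)) := fun {u} hu x hx =>
    ((lp.evalCLM ℝ (fun _ : {x' : X →L[ℝ] ℝ // ‖x'‖ ≤ 1} => ℝ) ∞ s).continuous.tendsto _).comp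
      (((hu x hx).tendsto.comp (hrlim x hx)).mono_left Nat.hyperfilter_le_atTop)
  have hHc := continuousOn_primitive_of_integrableOn (hinteg k)
  have hlim := (((happly hFc b hb').sub (happly hFc a ha')).sub
    ((happly hHc b hb').sub (happly hHc a ha'))).add (hη.mono_left Nat.hyperfilter_le_atTop)
  have hfin := le_of_tendsto_of_tendsto ((hφ' b hb' s.1).sub (hφ' a ha' s.1)) hlim ?_
  · rw [map_sub, ← hHsub k a b ha hab hb]
    simpa only [lp.coeFn_sub, Pi.sub_apply, add_zero] using hfin
  refine Nat.hyperfilter_le_atTop ?_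
  filter_upwards [eventually_ge_atTop k] with n hn
  have hle := hrm n ha' hb' hab
  have h1 := hinc n a b ha hab hb s
  have h2 := SuppSpace.integral_apply_mono (hinteg k) (hinteg n) (s := s)
    (fun t ht => SuppSpace.trunc_apply_mono (hγ0 t ht s) hn) (hrmem n a ha').1 hle
    (hrmem n b hb').2
  rw [← hHsub k _ _ (hrmem n a ha').1 hle (hrmem n b hb').2,
    ← hHsub n _ _ (hrmem n a ha').1 hle (hrmem n b hb').2] at h2
  simp only [lp.coeFn_sub, Pi.sub_apply] at h2
  linarith

end WeakLimit

section Decomposition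

variable {X : Type*} [NormedAddCommGroup X] [NormedSpace ℝ X]

/-- A function with increments dominated as in `exists_weak_limit_primitive` is a variational
Henstock primitive of `f`. -/
theorem perronControl_of_apply_sub_le {g F : ℝ → SuppSpace X} {f φ : ℝ → X}
    (hvar : VarHenstock g F)
    (hinteg : ∀ k, IntegrableOn (trunc g (fun t => g t - pointEmb X (f t)) k) (Icc 0 1))
    (hφ : ∀ (k : ℕ) (a b : ℝ), 0 ≤ a → a ≤ b → b ≤ 1 → ∀ s, s.1 (φ b - φ a)
      ≤ (F b - F a - ∫ x in a..b, trunc g (fun t => g t - pointEmb X (f t)) k x) s)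
    {ε : ℝ} (hε : 0 < ε) : ∃ δ V, PerronControl f φ δ V ε := by
  obtain ⟨δ, V, hV, -, -⟩ := hvar _ (half_pos hε)
  obtain ⟨δ', V', hδ', -, hV'm, hV', hV'b⟩ := exists_free_control hinteg (half_pos hε)
  refine ⟨fun t => min (δ t) (δ' ⌈‖g t‖⌉₊ t), fun x => V x + V' x,
    fun t ht => lt_min (hV.gauge t ht) (hδ' _ t), hV.mono.add hV'm, by linarith [hV.total], ?_⟩
  intro a b t ha hat htb hb hl hr
  have hm1 := min_le_left (δ t) (δ' ⌈‖g t‖⌉₊ t)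
  have hm2 := min_le_right (δ t) (δ' ⌈‖g t‖⌉₊ t)
  refine norm_le_of_forall_apply_le fun s => ?_
  have h1 := hφ ⌈‖g t‖⌉₊ a b ha (hat.trans htb) hb s
  have h2 := (le_abs_self _).trans ((SuppSpace.abs_le _ s).trans
    (hV.bound a b t ha hat htb hb (by linarith) (by linarith)))
  have h3 := neg_le_of_abs_le ((SuppSpace.abs_le _ s).trans
    (hV'b ⌈‖g t‖⌉₊ a b t ha (hat.trans htb) hb (by linarith) (by linarith)))
  rw [trunc_of_le (Nat.le_ceil _)] at h3
  simp only [lp.coeFn_sub, lp.coeFn_smul, Pi.sub_apply, Pi.smul_apply, smul_eq_mul, mul_sub,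
    map_sub, map_smul] at h1 h2 h3 ⊢
  simp only [pointEmb_apply] at h3
  linarith

/-- A coordinatewise nonnegative variationally Henstock integrable function is Birkhoff
integrable. -/
theorem exists_measurable_gauge_of_perronControl {g γ Ψ : ℝ → SuppSpace X}
    (hg : AEStronglyMeasurable g (volume.restrict (Icc 0 1)))
    (hinteg : ∀ k, IntegrableOn (trunc g γ k) (Icc 0 1))
    (hγ : ∀ t ∈ Icc (0:ℝ) 1, ∀ s, 0 ≤ γ t s)
    (hle : ∀ k s, (∫ x in (0:ℝ)..1, trunc g γ k x) s ≤ (Ψ 1 - Ψ 0) s)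
    (hvar : ∀ ε > 0, ∃ δ V, PerronControl γ Ψ δ V ε) {ε : ℝ} (hε : 0 < ε) :
    ∃ δ : ℝ → ℝ, IsGauge δ ∧ AEMeasurable δ volume ∧ ∀ (n : ℕ) (P : TP n), P.IsFine δ →
      ‖Ψ 1 - Ψ 0 - ∑ i, P.len i • γ (P.tag i)‖ ≤ ε := by
  have hε3 : 0 < ε / 3 := by positivity
  obtain ⟨δ, V, hV⟩ := hvar _ hε3
  obtain ⟨δ', V', hδ', hδ'm, hV'm, hV', hV'b⟩ := exists_free_control hinteg hε3
  set H : ℕ → ℝ → SuppSpace X := fun k x => ∫ y in (0:ℝ)..x, trunc g γ k y with hH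
  have hHsub : ∀ k a b, 0 ≤ a → a ≤ b → b ≤ 1 → ∀ s,
      (∫ x in a..b, trunc g γ k x) s = H k b s - H k a s := fun k a b ha hab hb s => by
    rw [← integral_sub_integral_of_integrableOn (hinteg k) ha hab hb]
    rfl
  have hHmono : ∀ {k n}, k ≤ n → ∀ a b, 0 ≤ a → a ≤ b → b ≤ 1 → ∀ s,
      H k b s - H k a s ≤ H n b s - H n a s := by
    intro k n hkn a b ha hab hb s
    rw [← hHsub k a b ha hab hb, ← hHsub n a b ha hab hb]
    exact SuppSpace.integral_apply_mono (hinteg k) (hinteg n)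
      (fun t ht => SuppSpace.trunc_apply_mono (hγ t ht s) hkn) ha hab hb
  have hH0 : ∀ k s, H k 0 s = 0 := fun k s => by simp [hH]
  have hfree : ∀ (k : ℕ) (a b t : ℝ), ‖g t‖ ≤ k → 0 ≤ a → a ≤ b → b ≤ 1 →
      t - δ' k t < a → b < t + δ' k t → ∀ s, |H k b s - H k a s - (b - a) * γ t s| ≤ V' b - V' a := by
    intro k a b t hk ha hab hb hl hr s
    have := (SuppSpace.abs_le _ s).trans (hV'b k a b t ha hab hb hl hr)
    rw [trunc_of_le hk] at this
    rw [← hHsub k a b ha hab hb]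
    exact this
  obtain ⟨N, hN⟩ : ∃ N, ∀ s, Ψ 1 s - Ψ 0 s - H N 1 s ≤ V 1 - V 0 + (V' 1 - V' 0) := by
    refine cousin_induction (δ := fun t => min (δ t) (δ' ⌈‖g t‖⌉₊ t))
      (Q := fun x => ∃ N, ∀ s, Ψ x s - Ψ 0 s - H N x s ≤ V x - V 0 + (V' x - V' 0))
      (fun t ht => lt_min (hV.gauge t ht) (hδ' _ t)) le_rfl ⟨0, fun s => by simp [hH0]⟩ ?_
      zero_le_one le_rfl
    rintro c d t hc hct htd hd hl hr ⟨N, hN⟩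
    have hm1 := min_le_left (δ t) (δ' ⌈‖g t‖⌉₊ t)
    have hm2 := min_le_right (δ t) (δ' ⌈‖g t‖⌉₊ t)
    have hcd := hct.trans htd
    refine ⟨max N ⌈‖g t‖⌉₊, fun s => ?_⟩
    have h1 := hHmono (le_max_left N ⌈‖g t‖⌉₊) 0 c le_rfl hc (hcd.trans hd) s
    have h2 := hHmono (le_max_right N ⌈‖g t‖⌉₊) c d hc hcd hd s
    have h3 := neg_le_of_abs_le (hfree ⌈‖g t‖⌉₊ c d t (Nat.le_ceil _) hc hcd hd
      (by linarith) (by linarith) s)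
    have h4 := (le_abs_self _).trans ((SuppSpace.abs_le _ s).trans
      (hV.bound c d t hc hct htd hd (by linarith) (by linarith)))
    simp only [lp.coeFn_sub, lp.coeFn_smul, Pi.sub_apply, Pi.smul_apply, smul_eq_mul] at h4
    rw [hH0, hH0] at h1
    linarith [hN s]
  set m : ℝ → ℕ := fun t => max ⌈‖g t‖⌉₊ N with hm
  have hmm : AEMeasurable m (volume.restrict (Icc 0 1)) :=
    (Nat.measurable_ceil.comp_aemeasurable hg.norm.aemeasurable).max aemeasurable_const
  have hδm : AEMeasurable (fun t => δ' (m t) t) (volume.restrict (Icc 0 1)) := by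
    refine ⟨fun t => (hδ'm (hmm.mk m t)).mk _ t, ?_, ?_⟩
    · exact (measurable_from_prod_countable_right fun k => (hδ'm k).measurable_mk :
        Measurable fun p : ℕ × ℝ => (hδ'm p.1).mk _ p.2).comp
          (hmm.measurable_mk.prodMk measurable_id)
    · filter_upwards [hmm.ae_eq_mk, ae_all_iff.2 fun k => (hδ'm k).ae_eq_mk] with t h1 h2
      rw [← h1]
      exact h2 _
  refine ⟨(Icc 0 1).indicator fun t => δ' (m t) t, fun t ht => ?_,
    (aemeasurable_indicator_iff measurableSet_Icc).2 hδm, fun n P hP => ?_⟩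
  · rw [indicator_of_mem ht]
    exact hδ' _ t
  have hb : ∀ i, ∀ s,
      |H (m (P.tag i)) (P.pt i.succ) s - H (m (P.tag i)) (P.pt i.castSucc) s
        - (P.len i) * γ (P.tag i) s| ≤ V' (P.pt i.succ) - V' (P.pt i.castSucc) := by
    intro i s
    have hle := P.castSucc_le_succ i
    have hl := hP i (left_mem_Icc.2 hle)
    have hr := hP i (right_mem_Icc.2 hle)
    rw [indicator_of_mem (P.tagMem i)] at hl hr
    exact hfree _ _ _ _ ((Nat.le_ceil _).trans (Nat.cast_le.2 (le_max_left _ _)))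
      (P.pt_nonneg _) hle (P.pt_le_one _) hl.1 hr.2 s
  obtain ⟨M, hM⟩ : ∃ M, ∀ i, m (P.tag i) ≤ M :=
    ⟨∑ i, m (P.tag i), fun i => Finset.single_le_sum (f := fun i => m (P.tag i))
      (fun _ _ => Nat.zero_le _) (Finset.mem_univ i)⟩
  refine SuppSpace.norm_le fun s => ?_
  have hsum : (Ψ 1 - Ψ 0 - ∑ i, P.len i • γ (P.tag i)) s
      = Ψ 1 s - Ψ 0 s - ∑ i, P.len i * γ (P.tag i) s := by
    rw [lp.coeFn_sub, lp.coeFn_sub, Pi.sub_apply, Pi.sub_apply, lp.coeFn_sum, Finset.sum_apply]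
    rfl
  have hup : ∑ i, P.len i * γ (P.tag i) s ≤ H M 1 s - H M 0 s + (V' 1 - V' 0) := by
    rw [← P.sum_increments fun x => H M x s, ← P.sum_increments V', ← Finset.sum_add_distrib]
    refine Finset.sum_le_sum fun i _ => ?_
    have h1 := neg_le_of_abs_le (hb i s)
    have h2 := hHmono (hM i) _ _ (P.pt_nonneg _) (P.castSucc_le_succ i) (P.pt_le_one _) s
    linarith
  have hlow : H N 1 s - H N 0 s - (V' 1 - V' 0) ≤ ∑ i, P.len i * γ (P.tag i) s := by
    rw [← P.sum_increments fun x => H N x s, ← P.sum_increments V', ← Finset.sum_sub_distrib]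
    refine Finset.sum_le_sum fun i _ => ?_
    have h1 := le_of_abs_le (hb i s)
    have h2 := hHmono (le_max_right ⌈‖g (P.tag i)‖⌉₊ N) _ _ (P.pt_nonneg _)
      (P.castSucc_le_succ i) (P.pt_le_one _) s
    linarith
  have hMle : H M 1 s ≤ Ψ 1 s - Ψ 0 s := hle M s
  have := hV.total
  rw [hH0] at hup hlow
  rw [hsum, abs_le]
  constructor <;> linarith [hN s]

end Decomposition

section Assembly

variable {X : Type*} [NormedAddCommGroup X] [NormedSpace ℝ X]

theorem IsCWK.suppEmb_add {A B : Set X} (hA : IsCWK X A) (hB : IsCWK X B) :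
    suppEmb (A + B) = suppEmb A + suppEmb B :=
  GaugePaper.suppEmb_add hA.1 hA.isBounded hB.1 hB.isBounded

theorem IsCWK.sum {ι : Type*} (S : Finset ι) {A : ι → Set X} (hA : ∀ i ∈ S, IsCWK X (A i)) :
    IsCWK X (∑ i ∈ S, A i) ∧ suppEmb (∑ i ∈ S, A i) = ∑ i ∈ S, suppEmb (A i) := by
  classical
  induction S using Finset.induction_on with
  | empty =>
    rw [Finset.sum_empty, Finset.sum_empty, ← singleton_zero]
    exact ⟨IsCWK.singleton 0, by rw [suppEmb_singleton, map_zero]⟩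
  | insert i S hi ih =>
    obtain ⟨h1, h2⟩ := ih fun j hj => hA j (Finset.mem_insert_of_mem hj)
    have hi' := hA i (Finset.mem_insert_self i S)
    rw [Finset.sum_insert hi, Finset.sum_insert hi, ← h2]
    exact ⟨hi'.add h1, hi'.suppEmb_add h1⟩

theorem isCWK_len_smul {Γ : ℝ → Set X} (hΓ : ∀ t ∈ Icc (0:ℝ) 1, IsCWK X (Γ t)) {n : ℕ} (P : TP n)
    (i : Fin n) : IsCWK X (P.len i • Γ (P.tag i)) :=
  (hΓ _ (P.tagMem i)).smul _

theorem suppEmb_len_smul {Γ : ℝ → Set X} (hΓ : ∀ t ∈ Icc (0:ℝ) 1, IsCWK X (Γ t)) {n : ℕ}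
    (P : TP n) (i : Fin n) :
    suppEmb (P.len i • Γ (P.tag i)) = P.len i • suppEmb (Γ (P.tag i)) :=
  suppEmb_smul (hΓ _ (P.tagMem i)).1 (hΓ _ (P.tagMem i)).isBounded
    (sub_nonneg.2 (P.castSucc_le_succ i))

theorem suppEmb_sub_suppEmb_of_additive {Φ : ℝ → ℝ → Set X}
    (hΦ : ∀ a b : ℝ, 0 ≤ a → a ≤ b → b ≤ 1 → IsCWK X (Φ a b)) (hadd : AdditiveIntervalMF Φ)
    {a b : ℝ} (ha : 0 ≤ a) (hab : a ≤ b) (hb : b ≤ 1) :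
    suppEmb (Φ 0 b) - suppEmb (Φ 0 a) = suppEmb (Φ a b) := by
  rw [hadd 0 a b le_rfl ha hab hb,
    (hΦ 0 a le_rfl ha (hab.trans hb)).suppEmb_add (hΦ a b ha hab hb), add_sub_cancel_left]

theorem hausdorffDist_len_smul {Γ : ℝ → Set X} {Φ : ℝ → ℝ → Set X}
    (hΓ : ∀ t ∈ Icc (0:ℝ) 1, IsCWK X (Γ t))
    (hΦ : ∀ a b : ℝ, 0 ≤ a → a ≤ b → b ≤ 1 → IsCWK X (Φ a b)) (hadd : AdditiveIntervalMF Φ)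
    {n : ℕ} (P : TP n) (i : Fin n) :
    hausdorffDist (Φ (P.pt i.castSucc) (P.pt i.succ)) (P.len i • Γ (P.tag i))
      = ‖suppEmb (Φ 0 (P.pt i.succ)) - suppEmb (Φ 0 (P.pt i.castSucc))
          - P.len i • suppEmb (Γ (P.tag i))‖ := by
  have h := P.castSucc_le_succ i
  rw [hausdorffDist_eq_norm_suppEmb_sub (hΦ _ _ (P.pt_nonneg _) h (P.pt_le_one _))
    (isCWK_len_smul hΓ P i), suppEmb_len_smul hΓ,
    suppEmb_sub_suppEmb_of_additive hΦ hadd (P.pt_nonneg _) h (P.pt_le_one _)]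

theorem vHPrimitive.varHenstock {Γ : ℝ → Set X} {Φ : ℝ → ℝ → Set X}
    (hΓ : ∀ t ∈ Icc (0:ℝ) 1, IsCWK X (Γ t)) (h : vHPrimitive Γ Φ) :
    VarHenstock (fun t => suppEmb (Γ t)) fun x => suppEmb (Φ 0 x) := by
  refine varHenstock_of_sum_lt fun ε hε => ?_
  obtain ⟨δ, hδ, hsum⟩ := h.2.2 ε hε
  refine ⟨δ, hδ, fun n P hP hfine => ?_⟩
  simpa only [hausdorffDist_len_smul hΓ h.1 h.2.1] using hsum n P hP hfine

theorem vHPrimitive_of_perronControl {Γ : ℝ → Set X} {Φ : ℝ → ℝ → Set X}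
    (hΓ : ∀ t ∈ Icc (0:ℝ) 1, IsCWK X (Γ t))
    (hΦ : ∀ a b : ℝ, 0 ≤ a → a ≤ b → b ≤ 1 → IsCWK X (Φ a b)) (hadd : AdditiveIntervalMF Φ)
    {γ Ψ : ℝ → SuppSpace X} (hγ : ∀ t ∈ Icc (0:ℝ) 1, γ t = suppEmb (Γ t))
    (hΨ : ∀ x ∈ Icc (0:ℝ) 1, Ψ x = suppEmb (Φ 0 x))
    (h : ∀ ε > 0, ∃ δ V, PerronControl γ Ψ δ V ε) : vHPrimitive Γ Φ := by
  refine ⟨hΦ, hadd, fun ε hε => ?_⟩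
  obtain ⟨δ, V, hV⟩ := h _ (half_pos hε)
  refine ⟨δ, hV.gauge, fun n P hP hfine => lt_of_eq_of_lt (Finset.sum_congr rfl fun i _ => ?_)
    ((hV.sum_le P hP hfine).trans_lt (half_lt_self hε))⟩
  rw [hausdorffDist_len_smul hΓ hΦ hadd, hγ _ (P.tagMem i), hΨ _ ⟨P.pt_nonneg _, P.pt_le_one _⟩,
    hΨ _ ⟨P.pt_nonneg _, P.pt_le_one _⟩]

theorem birkhoffIntegrable_of_norm_sub_sum_le {Γ : ℝ → Set X} {I : Set X}
    (hΓ : ∀ t ∈ Icc (0:ℝ) 1, IsCWK X (Γ t)) (hI : IsCWK X I)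
    (h : ∀ ε > 0, ∃ δ : ℝ → ℝ, IsGauge δ ∧ AEMeasurable δ volume ∧ ∀ (n : ℕ) (P : TP n),
      P.IsFine δ → ‖suppEmb I - ∑ i, P.len i • suppEmb (Γ (P.tag i))‖ ≤ ε) :
    BirkhoffIntegrable Γ := by
  refine ⟨I, hI, fun ε hε => ?_⟩
  obtain ⟨δ, hδ, hδm, hsum⟩ := h _ (half_pos hε)
  refine ⟨δ, hδ, hδm, fun n P hP => lt_of_le_of_lt ?_ (half_lt_self hε)⟩
  obtain ⟨h1, h2⟩ := IsCWK.sum Finset.univ fun i _ => isCWK_len_smul hΓ P i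
  rw [mSum, hausdorffDist_eq_norm_suppEmb_sub hI h1, h2]
  simpa only [suppEmb_len_smul hΓ] using hsum n P hP

theorem PerronControl.fvHPrimitive {f φ : ℝ → X}
    (h : ∀ ε > 0, ∃ δ V, PerronControl f φ δ V ε) : FvHPrimitive f fun a b => φ b - φ a := by
  refine ⟨fun a b c _ _ _ _ => by simp, fun ε hε => ?_⟩
  obtain ⟨δ, V, hV⟩ := h _ (half_pos hε)
  exact ⟨δ, hV.gauge, fun n P hP hfine => (hV.sum_le P hP hfine).trans_lt (half_lt_self hε)⟩

theorem PerronControl.sub_pointEmb {g F : ℝ → SuppSpace X} {f φ : ℝ → X} {δ V δ' V' : ℝ → ℝ}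
    {ε ε' : ℝ} (hV : PerronControl g F δ V ε) (hV' : PerronControl f φ δ' V' ε') :
    PerronControl (fun t => g t - pointEmb X (f t)) (fun x => F x - pointEmb X (φ x))
      (fun t => min (δ t) (δ' t)) (fun x => V x + V' x) (ε + ε') := by
  refine ⟨fun t ht => lt_min (hV.gauge t ht) (hV'.gauge t ht), hV.mono.add hV'.mono,
    by linarith [hV.total, hV'.total], fun a b t ha hat htb hb hl hr => ?_⟩
  have hm1 := min_le_left (δ t) (δ' t)
  have hm2 := min_le_right (δ t) (δ' t)
  have h1 := hV.bound a b t ha hat htb hb (by linarith) (by linarith)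
  have h2 := hV'.bound a b t ha hat htb hb (by linarith) (by linarith)
  have h3 := norm_pointEmb_le (φ b - φ a - (b - a) • f t)
  calc _ = ‖(F b - F a - (b - a) • g t) - pointEmb X (φ b - φ a - (b - a) • f t)‖ := by
        simp only [map_sub, map_smul, smul_sub]
        congr 1
        abel
    _ ≤ _ := (norm_sub_le _ _).trans (by linarith)

end Assembly

/-- Theorem `decofinal` of the paper. Every variationally Henstock
integrable multifunction `Γ : [0,1] → cwk(X)` is the sum `Γ = G + f` of a variationally
Henstock integrable selection `f` of `Γ` and a multifunction `G : [0,1] → cwk(X)` that is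
both Birkhoff integrable and variationally Henstock integrable. -/
theorem vH_decomposition
    {X : Type*} [NormedAddCommGroup X] [NormedSpace ℝ X] [CompleteSpace X]
    (Γ : ℝ → Set X) (hΓ : ∀ t ∈ Icc (0:ℝ) 1, IsCWK X (Γ t))
    (h : vHIntegrable Γ) :
    ∃ (f : ℝ → X) (G : ℝ → Set X),
      Selection Γ f ∧ FvHIntegrable f ∧
      (∀ t ∈ Icc (0:ℝ) 1, IsCWK X (G t)) ∧
      (∀ t ∈ Icc (0:ℝ) 1, Γ t = G t + ({f t} : Set X)) ∧
      BirkhoffIntegrable G ∧ vHIntegrable G := by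
  obtain ⟨Φ, hΦ⟩ := h
  have hvar := hΦ.varHenstock hΓ
  obtain ⟨hΦcwk, hΦadd, -⟩ := hΦ
  set g : ℝ → SuppSpace X := fun t => suppEmb (Γ t) with hg
  set F : ℝ → SuppSpace X := fun x => suppEmb (Φ 0 x) with hF
  have hgm := hvar.aestronglyMeasurable
  obtain ⟨f, hfΓ, hfm⟩ := exists_aestronglyMeasurable_selection hΓ hgm
  have hfg : ∀ t ∈ Icc (0:ℝ) 1, ∀ s, s.1 (f t) ≤ g t s := fun t ht s =>
    (le_suppFn s.1 (hΓ t ht).isBounded (hfΓ t ht)).trans_eq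
      (suppEmb_apply (hΓ t ht).1 (hΓ t ht).isBounded s).symm
  have hF0 : F 0 = 0 := by
    have := suppEmb_sub_suppEmb_of_additive hΦcwk hΦadd le_rfl le_rfl zero_le_one
    rw [sub_self] at this
    exact this.symm
  obtain ⟨φ, hφ⟩ := exists_weak_limit_primitive
    (fun x hx => hΦcwk 0 x le_rfl hx.1 hx.2) (fun _ _ => rfl) hF0 hvar hfm hfg
  set γ : ℝ → SuppSpace X := fun t => g t - pointEmb X (f t) with hγ
  have hinteg : ∀ k, IntegrableOn (trunc g γ k) (Icc 0 1) :=
    integrableOn_trunc_sub_pointEmb hgm hfm hfg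
  have hcf := fun ε (hε : (0:ℝ) < ε) => perronControl_of_apply_sub_le hvar hinteg hφ hε
  have hcγ : ∀ ε > 0, ∃ δ V, PerronControl γ (fun x => F x - pointEmb X (φ x)) δ V ε := by
    intro ε hε
    obtain ⟨δ, V, hV, -⟩ := hvar _ (half_pos hε)
    obtain ⟨δ', V', hV'⟩ := hcf _ (half_pos hε)
    have := hV.sub_pointEmb hV'
    rw [add_halves] at this
    exact ⟨_, _, this⟩
  have hG : ∀ t ∈ Icc (0:ℝ) 1, IsCWK X (Γ t + {-f t}) := fun t ht =>
    (hΓ t ht).add (IsCWK.singleton _)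
  have hGγ : ∀ t ∈ Icc (0:ℝ) 1, γ t = suppEmb (Γ t + {-f t}) := fun t ht => by
    rw [(hΓ t ht).suppEmb_add (IsCWK.singleton _), suppEmb_singleton, map_neg, ← sub_eq_add_neg]
  have hΨcwk : ∀ a b : ℝ, 0 ≤ a → a ≤ b → b ≤ 1 → IsCWK X (Φ a b + {-(φ b - φ a)}) :=
    fun a b ha hab hb => (hΦcwk a b ha hab hb).add (IsCWK.singleton _)
  have hΨ : ∀ x ∈ Icc (0:ℝ) 1,
      F x - pointEmb X (φ x) + pointEmb X (φ 0) = suppEmb (Φ 0 x + {-(φ x - φ 0)}) :=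
    fun x hx => by
      rw [(hΦcwk 0 x le_rfl hx.1 hx.2).suppEmb_add (IsCWK.singleton _), suppEmb_singleton, map_neg,
        map_sub]
      abel
  refine ⟨f, fun t => Γ t + {-f t}, hfΓ, ⟨_, PerronControl.fvHPrimitive hcf⟩, hG, fun t _ => ?_,
    birkhoffIntegrable_of_norm_sub_sum_le hG (hΨcwk 0 1 le_rfl zero_le_one le_rfl) fun ε hε => ?_,
    _, vHPrimitive_of_perronControl hG hΨcwk ?_ hGγ hΨ fun ε hε => ?_⟩
  · rw [add_assoc, singleton_add_singleton, neg_add_cancel, singleton_zero, add_zero]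
  · have hle : ∀ k s, (∫ x in (0:ℝ)..1, trunc g γ k x) s
        ≤ (F 1 - pointEmb X (φ 1) - (F 0 - pointEmb X (φ 0))) s := fun k s => by
      have := hφ k 0 1 le_rfl zero_le_one le_rfl s
      simp only [lp.coeFn_sub, Pi.sub_apply, pointEmb_apply, map_sub] at this ⊢
      linarith
    obtain ⟨δ, hδ, hδm, hsum⟩ := exists_measurable_gauge_of_perronControl hgm hinteg
      (fun t ht s => sub_nonneg.2 (hfg t ht s)) hle hcγ hε
    refine ⟨δ, hδ, hδm, fun n P hP => (le_of_eq ?_).trans (hsum n P hP)⟩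
    rw [← hΨ 1 ⟨zero_le_one, le_rfl⟩, hF0, zero_sub, sub_neg_eq_add,
      Finset.sum_congr rfl fun i _ => by rw [← hGγ _ (P.tagMem i)]]
  · intro a b c ha hab hbc hc
    simp only
    rw [hΦadd a b c ha hab hbc hc, add_add_add_comm, singleton_add_singleton]
    congr 2
    abel
  · obtain ⟨δ, V, hV⟩ := hcγ ε hε
    refine ⟨δ, V, hV.gauge, hV.mono, hV.total, fun a b t ha hat htb hb hl hr => ?_⟩
    simpa only [add_sub_add_right_eq_sub] using hV.bound a b t ha hat htb hb hl hr

end GaugePaper
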